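/- arXiv:1803.03060 — 4 statements merged into one kernel-verified Lean document; each statement's English description precedes it below -/
import Mathlib

section
/- There exist constants α_A, α_D > 0 such that for all sufficiently large k the following holds. Let H=(V,E) be a hypergraph with s_min(H) ≥ k and q := q(H) ≥ 1, run the random two-phase coloring, and fix an edge e ∈ E of size s. Define the random variable Y_e := ∑ 1/|f|, summed over edges f ∈ E with |f ∩ e| = 1 such that all vertices of f∖e are initially colored blue (Y_e is determined by the initial colors of the vertices outside e). Then for every value y with P[Y_e = y] > 0, the conditional probability, given Y_e = y, that all vertices of e receive final color red and neither bad event A nor bad event D occurs, is at most (cosh(√(2·α_D·q·y)) − 1)/2^s. -/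
open MeasureTheory Finset
open scoped Classical

/-- The uniform probability measure on `{blue, red}` (blue = `true`, red = `false`). -/
noncomputable def muBool : Measure Bool := (PMF.uniformOfFintype Bool).toMeasure

/-- The uniform probability measure on the interval `(0,1)`. -/
noncomputable def muW : Measure ℝ := volume.restrict (Set.Ioo (0 : ℝ) 1)

/-- The random two-phase coloring model: each vertex independently receives a uniform
initial color (first component) and a uniform weight in `(0,1)` (second component). -/
noncomputable def muH (V : Type) [Fintype V] : Measure ((V → Bool) × (V → ℝ)) :=
  (Measure.pi fun _ : V => muBool).prod (Measure.pi fun _ : V => muW)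

/-- `q(H) = ∑_{f ∈ E} 2^{-|f|+1}`. -/
noncomputable def qH {V : Type} (E : Finset (Finset V)) : ℝ :=
  ∑ f ∈ E, (2 : ℝ) ^ (1 - (f.card : ℤ))

/-- `f` is (initially) monochromatic under `ic`. -/
def Mono {V : Type} (ic : V → Bool) (f : Finset V) : Prop :=
  ∀ u ∈ f, ∀ v ∈ f, ic u = ic v

/-- Edge `f` is a reason to recolor `v` (given partial final coloring `c`): `v ∈ f ∈ E`,
`f` is initially monochromatic, `v` is the maximum-weight vertex of `f`, and every other
vertex of `f` keeps its initial color. -/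
def Reason {V : Type} (E : Finset (Finset V)) (ic : V → Bool) (w : V → ℝ)
    (c : V → Bool) (v : V) : Prop :=
  ∃ f ∈ E, v ∈ f ∧ Mono ic f ∧ (∀ u ∈ f, w u ≤ w v) ∧ ∀ u ∈ f, u ≠ v → c u = ic u

/-- `c` is the final coloring produced by the recoloring procedure (processing vertices in
order of increasing weight): `c v` differs from `ic v` iff there is a reason to recolor `v`.
For an injective weight function this recurrence determines `c` uniquely. -/
def IsFinalColoring {V : Type} (E : Finset (Finset V)) (ic : V → Bool) (w : V → ℝ)
    (c : V → Bool) : Prop :=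
  ∀ v, (Reason E ic w c v → c v = !(ic v)) ∧ (¬ Reason E ic w c v → c v = ic v)

/-- Bad event `A`: more than `αA·q` edges are initially monochromatic. -/
def BadA {V : Type} (E : Finset (Finset V)) (aA q : ℝ) (ic : V → Bool) : Prop :=
  aA * q < ((E.filter fun f => Mono ic f).card : ℝ)

/-- Bad event `B`: some edge `f` is light, i.e. initially monochromatic with all weights
below `1 − p_{|f|}` where `p_j = ln(αB·q)/j`. -/
def BadB {V : Type} (E : Finset (Finset V)) (aB q : ℝ) (ic : V → Bool) (w : V → ℝ) : Prop :=
  ∃ f ∈ E, Mono ic f ∧ ∀ v ∈ f, w v < 1 - Real.log (aB * q) / (f.card : ℝ)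

/-- `f` is almost monochromatic under `ic`. -/
def AlmostMono {V : Type} (ic : V → Bool) (f : Finset V) : Prop :=
  ∃ v ∈ f, ∀ u ∈ f, u ≠ v → ∀ u' ∈ f, u' ≠ v → ic u = ic u'

/-- Bad event `C`: `∑_j Q_j/j > αC·q`, where `Q_j` is the number of almost monochromatic
edges of size `j` (the sum below is over the almost monochromatic edges, weighted `1/|f|`). -/
def BadC {V : Type} (E : Finset (Finset V)) (aC q : ℝ) (ic : V → Bool) : Prop :=
  aC * q < ∑ f ∈ E.filter fun f => AlmostMono ic f, (1 : ℝ) / (f.card : ℝ)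

/-- The second-largest weight among the vertices of `f`. -/
noncomputable def secondWeight {V : Type} [DecidableEq V] (f : Finset V) (w : V → ℝ) : ℝ :=
  sSup ((f.offDiag.image fun p => min (w p.1) (w p.2) : Finset ℝ) : Set ℝ)

/-- The second weight deficit `d₂(f) := (|f|+1)(1 − w₂(f))` for initially monochromatic `f`,
and `0` otherwise. -/
noncomputable def d2 {V : Type} [DecidableEq V] (f : Finset V) (ic : V → Bool)
    (w : V → ℝ) : ℝ :=
  if Mono ic f then ((f.card : ℝ) + 1) * (1 - secondWeight f w) else 0

/-- Bad event `D`: `∑_{f ∈ E} d₂(f) > αD·q`. -/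
def BadD {V : Type} [DecidableEq V] (E : Finset (Finset V)) (aD q : ℝ) (ic : V → Bool)
    (w : V → ℝ) : Prop :=
  aD * q < ∑ f ∈ E, d2 f ic w

/-- `Y_e := ∑ 1/|f|`, summed over the edges `f ∈ E` with `|f ∩ e| = 1` all of whose vertices
outside `e` are initially blue. -/
noncomputable def Yvar {V : Type} [DecidableEq V] (E : Finset (Finset V)) (e : Finset V)
    (ic : V → Bool) : ℝ :=
  ∑ f ∈ E.filter fun f => (f ∩ e).card = 1 ∧ ∀ u ∈ f, u ∉ e → ic u = true,
    (1 : ℝ) / (f.card : ℝ)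

/-- AM-GM in product form. -/
theorem prod_le_avg_pow_card {ι : Type*} (s : Finset ι) (z : ι → ℝ) (hz : ∀ i ∈ s, 0 ≤ z i) :
    ∏ i ∈ s, z i ≤ ((∑ i ∈ s, z i) / s.card) ^ s.card := by
  rcases s.eq_empty_or_nonempty with rfl | hs
  · simp
  have hc : (s.card : ℝ) ≠ 0 := by exact_mod_cast hs.card_ne_zero
  have h := Real.geom_mean_le_arith_mean_weighted s (fun _ => (s.card : ℝ)⁻¹) z
    (fun _ _ => by positivity) (by simp [hc]) hz
  rw [← Finset.mul_sum, inv_mul_eq_div, Real.finsetProd_rpow s z hz] at h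
  have hp : 0 ≤ ∏ i ∈ s, z i := Finset.prod_nonneg hz
  calc ∏ i ∈ s, z i = ((∏ i ∈ s, z i) ^ (s.card : ℝ)⁻¹) ^ s.card :=
        (Real.rpow_inv_natCast_pow hp hs.card_ne_zero).symm
    _ ≤ _ := pow_le_pow_left₀ (Real.rpow_nonneg hp _) h _

/-- The elementary symmetric polynomial of degree `t` at a nonnegative point is at most
`(∑ y)^t / t!`. -/
theorem sum_powersetCard_prod_le {ι : Type*} (s : Finset ι) (y : ι → ℝ) (hy : ∀ i, 0 ≤ y i)
    (t : ℕ) :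
    ∑ T ∈ s.powersetCard t, ∏ i ∈ T, y i ≤ (∑ i ∈ s, y i) ^ t / t.factorial := by
  induction s using Finset.induction_on generalizing t with
  | empty =>
    rcases t with _ | t
    · simp
    · simp [Finset.powersetCard_eq_empty.mpr (show (∅ : Finset ι).card < t + 1 by simp)]
  | insert a s ha ih =>
    rcases t with _ | t
    · simp
    have hS : 0 ≤ ∑ i ∈ s, y i := Finset.sum_nonneg fun i _ => hy i
    have hinj : Set.InjOn (insert a) (s.powersetCard t : Set (Finset ι)) := by
      intro A hA B hB hAB
      have hA' : a ∉ A := fun h => ha ((Finset.mem_powersetCard.mp hA).1 h)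
      have hB' : a ∉ B := fun h => ha ((Finset.mem_powersetCard.mp hB).1 h)
      rw [← Finset.erase_insert hA', ← Finset.erase_insert hB', hAB]
    have hdisj : Disjoint (s.powersetCard (t + 1)) ((s.powersetCard t).image (insert a)) := by
      rw [Finset.disjoint_left]
      rintro A hA hA'
      obtain ⟨B, -, rfl⟩ := Finset.mem_image.mp hA'
      exact ha ((Finset.mem_powersetCard.mp hA).1 (Finset.mem_insert_self a B))
    have hprod : ∑ T ∈ s.powersetCard t, ∏ i ∈ insert a T, y i =
        y a * ∑ T ∈ s.powersetCard t, ∏ i ∈ T, y i := by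
      rw [Finset.mul_sum]
      refine Finset.sum_congr rfl fun T hT => Finset.prod_insert fun h => ?_
      exact ha ((Finset.mem_powersetCard.mp hT).1 h)
    rw [Finset.powersetCard_succ_insert ha, Finset.sum_union hdisj, Finset.sum_image hinj, hprod,
      Finset.sum_insert ha]
    have hpow : (∑ i ∈ s, y i) ^ (t + 1) + (t + 1) * (∑ i ∈ s, y i) ^ t * y a ≤
        (y a + ∑ i ∈ s, y i) ^ (t + 1) := by
      have := pow_add_mul_le_add_pow hS (show 0 ≤ 2 * ∑ i ∈ s, y i + y a by linarith [hy a]) (t + 1)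
      simpa [add_comm, mul_comm, mul_assoc, mul_left_comm] using this
    calc _ ≤ (∑ i ∈ s, y i) ^ (t + 1) / (t + 1).factorial +
          y a * ((∑ i ∈ s, y i) ^ t / t.factorial) :=
          add_le_add (ih _) (mul_le_mul_of_nonneg_left (ih _) (hy a))
      _ = ((∑ i ∈ s, y i) ^ (t + 1) + (t + 1) * (∑ i ∈ s, y i) ^ t * y a) /
          (t + 1).factorial := by
          rw [Nat.factorial_succ]
          push_cast
          have : (t.factorial : ℝ) ≠ 0 := by positivity
          field_simp
      _ ≤ _ := by gcongr

/-- For a nonempty set `T` of initially blue vertices of `e`, the bound on the probability that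
every vertex of `T` is recolored while the total second weight deficit is at most `D`. -/
noncomputable def recolorBound {ι : Type*} (D : ℝ) (y : ι → ℝ) (T : Finset ι) : ℝ :=
  if T.Nonempty then (D / T.card) ^ T.card * ∏ i ∈ T, y i else 0

theorem recolorBound_nonneg {ι : Type*} {D : ℝ} (hD : 0 ≤ D) {y : ι → ℝ} (hy : ∀ i, 0 ≤ y i)
    (T : Finset ι) : 0 ≤ recolorBound D y T := by
  unfold recolorBound
  split_ifs
  · exact mul_nonneg (by positivity) (Finset.prod_nonneg fun i _ => hy i)
  · exact le_rfl

theorem sum_recolorBound_le {ι : Type*} (s : Finset ι) {D : ℝ} (hD : 0 ≤ D) {y : ι → ℝ}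
    (hy : ∀ i, 0 ≤ y i) :
    ∑ T ∈ s.powerset, recolorBound D y T ≤
      Real.cosh (Real.sqrt (2 * D * ∑ i ∈ s, y i)) - 1 := by
  set Y := ∑ i ∈ s, y i
  have hY : 0 ≤ Y := Finset.sum_nonneg fun i _ => hy i
  have hterm (t : ℕ) : ∑ T ∈ s.powersetCard (t + 1), recolorBound D y T ≤
      Real.sqrt (2 * D * Y) ^ (2 * (t + 1)) / (2 * (t + 1)).factorial := by
    set n := t + 1 with hn
    have hn0 : (0 : ℝ) < n := by rw [hn]; positivity
    have hsum : ∑ T ∈ s.powersetCard n, recolorBound D y T =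
        (D / n) ^ n * ∑ T ∈ s.powersetCard n, ∏ i ∈ T, y i := by
      rw [Finset.mul_sum]
      refine Finset.sum_congr rfl fun T hT => ?_
      have hc := (Finset.mem_powersetCard.mp hT).2
      rw [recolorBound, if_pos (Finset.card_pos.mp (by omega)), hc]
    have hfac : ((2 * n).factorial : ℝ) ≤ (2 * n) ^ n * n.factorial := by
      exact_mod_cast Nat.factorial_two_mul_le n
    rw [hsum, pow_mul, Real.sq_sqrt (by positivity)]
    calc (D / n) ^ n * ∑ T ∈ s.powersetCard n, ∏ i ∈ T, y i
        ≤ (D / n) ^ n * (Y ^ n / n.factorial) := by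
          gcongr
          exact sum_powersetCard_prod_le s y hy n
      _ = (2 * D * Y) ^ n / ((2 * n) ^ n * n.factorial) := by
          simp only [div_pow, mul_pow]
          field_simp
      _ ≤ _ := by gcongr
  have hcosh := Real.hasSum_cosh (Real.sqrt (2 * D * Y))
  have hle := sum_le_hasSum (Finset.range (s.card + 1)) (fun i _ => by positivity) hcosh
  rw [Finset.sum_range_succ'] at hle
  rw [Finset.sum_powerset, Finset.sum_range_succ']
  have h0 : ∑ T ∈ s.powersetCard 0, recolorBound D y T = 0 := by
    simp [recolorBound]
  rw [h0, add_zero]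
  have := Finset.sum_le_sum fun t (_ : t ∈ Finset.range s.card) => hterm t
  simp only [mul_zero, pow_zero, Nat.factorial_zero, Nat.cast_one, div_one] at hle
  linarith

instance : IsProbabilityMeasure muBool := by
  unfold muBool
  infer_instance

instance : IsProbabilityMeasure muW := ⟨by simp [muW]⟩

theorem muW_Ici_le (x : ℝ) : muW (Set.Ici x) ≤ ENNReal.ofReal (1 - x) := by
  rw [muW, Measure.restrict_apply measurableSet_Ici, ← Real.volume_Ico]
  exact measure_mono fun z hz => ⟨hz.1, hz.2.2⟩

/-- If the thresholds `M v`, `v ∈ T`, are determined by the weights outside `T`, then the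
weights in `T` exceed their thresholds with conditional probability at most `∏ (1 - M v)`, which
AM-GM bounds in terms of a weighted sum of the deficits `1 - M v`. -/
theorem pi_muW_threshold_le {V : Type} [Fintype V] (T : Finset V) (M : V → (V → ℝ) → ℝ)
    (hM : ∀ v, Measurable (M v))
    (hdep : ∀ v ∈ T, ∀ w w' : V → ℝ, (∀ u ∉ T, w u = w' u) → M v w = M v w')
    (c : V → ℝ) (hc : ∀ v, 0 < c v) (D : ℝ) :
    Measure.pi (fun _ : V => muW)
        {w | (∀ v ∈ T, M v w ≤ w v ∧ M v w ≤ 1) ∧ ∑ v ∈ T, c v * (1 - M v w) ≤ D} ≤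
      ENNReal.ofReal ((D / T.card) ^ T.card * ∏ v ∈ T, (c v)⁻¹) := by
  set S := {w : V → ℝ | (∀ v ∈ T, M v w ≤ w v ∧ M v w ≤ 1) ∧ ∑ v ∈ T, c v * (1 - M v w) ≤ D}
  set K := ENNReal.ofReal ((D / T.card) ^ T.card * ∏ v ∈ T, (c v)⁻¹)
  have hS : MeasurableSet S := by
    have hsum : Measurable fun w => ∑ v ∈ T, c v * (1 - M v w) := by fun_prop
    refine MeasurableSet.inter ?_ (measurableSet_le hsum measurable_const)
    have : {w : V → ℝ | ∀ v ∈ T, M v w ≤ w v ∧ M v w ≤ 1} =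
        ⋂ v ∈ T, {w | M v w ≤ w v} ∩ {w | M v w ≤ 1} := by
      ext w; simp
    change MeasurableSet {w : V → ℝ | ∀ v ∈ T, M v w ≤ w v ∧ M v w ≤ 1}
    rw [this]
    exact Finset.measurableSet_biInter _ fun v _ =>
      (measurableSet_le (hM v) (measurable_pi_apply v)).inter
        (measurableSet_le (hM v) measurable_const)
  let φ := MeasurableEquiv.piEquivPiSubtypeProd (fun _ : V => ℝ) (· ∈ T)
  have hφ := (measurePreserving_piEquivPiSubtypeProd (fun _ : V => muW) (· ∈ T)).symm
  have hin (a b) (v) (hv : v ∈ T) : φ.symm (a, b) v = a ⟨v, hv⟩ := by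
    change (if h : v ∈ T then a ⟨v, h⟩ else b ⟨v, h⟩) = _
    rw [dif_pos hv]
  have hout (a b) (v) (hv : v ∉ T) : φ.symm (a, b) v = b ⟨v, hv⟩ := by
    change (if h : v ∈ T then a ⟨v, h⟩ else b ⟨v, h⟩) = _
    rw [dif_neg hv]
  rw [← hφ.measure_preimage hS.nullMeasurableSet,
    Measure.prod_apply_symm (hφ.measurable hS)]
  have hslice (b : {v // v ∉ T} → ℝ) :
      Measure.pi (fun _ : {v // v ∈ T} => muW) ((fun a => (a, b)) ⁻¹' (φ.symm ⁻¹' S)) ≤ K := by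
    rcases Set.eq_empty_or_nonempty ((fun a => (a, b)) ⁻¹' (φ.symm ⁻¹' S)) with h | ⟨a₀, ha₀⟩
    · simp [h]
    set m : V → ℝ := fun v => M v (φ.symm (a₀, b))
    have hm (a) (v) (hv : v ∈ T) : M v (φ.symm (a, b)) = m v :=
      hdep v hv _ _ fun u hu => by rw [hout _ _ _ hu, hout _ _ _ hu]
    have hm1 : ∀ v ∈ T, 0 ≤ 1 - m v := fun v hv => sub_nonneg.mpr (ha₀.1 v hv).2
    have hsub : (fun a => (a, b)) ⁻¹' (φ.symm ⁻¹' S) ⊆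
        Set.univ.pi fun v : {v // v ∈ T} => Set.Ici (m v) := by
      intro a ha v _
      have := (ha.1 v v.2).1
      rwa [hm a v v.2, hin _ _ _ v.2] at this
    calc _ ≤ Measure.pi (fun _ : {v // v ∈ T} => muW)
            (Set.univ.pi fun v : {v // v ∈ T} => Set.Ici (m v)) := measure_mono hsub
      _ = ∏ v : {v // v ∈ T}, muW (Set.Ici (m v)) := Measure.pi_pi _ _
      _ ≤ ∏ v : {v // v ∈ T}, ENNReal.ofReal (1 - m v) :=
          Finset.prod_le_prod' fun v _ => muW_Ici_le _
      _ = ENNReal.ofReal (∏ v ∈ T, (1 - m v)) := by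
          rw [ENNReal.ofReal_prod_of_nonneg hm1]
          exact Finset.prod_coe_sort T fun v => ENNReal.ofReal (1 - m v)
      _ ≤ K := by
          refine ENNReal.ofReal_le_ofReal ?_
          have hnn : ∀ v ∈ T, 0 ≤ c v * (1 - m v) := fun v hv => mul_nonneg (hc v).le (hm1 v hv)
          have hprod : ∏ v ∈ T, (1 - m v) =
              (∏ v ∈ T, c v * (1 - m v)) * ∏ v ∈ T, (c v)⁻¹ := by
            rw [← Finset.prod_mul_distrib]
            refine Finset.prod_congr rfl fun v _ => ?_
            have := (hc v).ne'
            field_simp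
          rw [hprod]
          refine mul_le_mul_of_nonneg_right ?_
            (Finset.prod_nonneg fun v _ => (inv_pos.mpr (hc v)).le)
          refine (prod_le_avg_pow_card T _ hnn).trans ?_
          have h1 : 0 ≤ ∑ v ∈ T, c v * (1 - m v) := Finset.sum_nonneg hnn
          have h2 : ∑ v ∈ T, c v * (1 - m v) ≤ D := ha₀.2
          gcongr
  refine (lintegral_mono (g := fun _ => K) fun b => ?_).trans (by simp)
  convert hslice b

/-- Almost surely the weights are distinct and lie in `(0,1)`. -/
theorem ae_injective_and_mem_Ioo (V : Type) [Fintype V] :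
    ∀ᵐ w ∂Measure.pi (fun _ : V => muW),
      Function.Injective w ∧ ∀ v, w v ∈ Set.Ioo (0 : ℝ) 1 := by
  have hpi : Measure.pi (fun _ : V => muW) =
      (volume : Measure (V → ℝ)).restrict (Set.univ.pi fun _ => Set.Ioo (0 : ℝ) 1) := by
    rw [volume_pi, Measure.restrict_pi_pi]
    rfl
  have hne (u v : V) (huv : u ≠ v) : ∀ᵐ w : V → ℝ, w u ≠ w v := by
    let L : Submodule ℝ (V → ℝ) :=
      LinearMap.ker (LinearMap.proj (R := ℝ) (φ := fun _ : V => ℝ) u - LinearMap.proj v)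
    have hL : L ≠ ⊤ := by
      intro h
      have : Pi.single u (1 : ℝ) ∈ L := h ▸ Submodule.mem_top
      simp [L, huv.symm] at this
    have h0 := Measure.addHaar_submodule (volume : Measure (V → ℝ)) L hL
    refine measure_mono_null (fun w hw => ?_) h0
    simpa [L, sub_eq_zero] using hw
  rw [hpi]
  filter_upwards [ae_restrict_mem (MeasurableSet.univ_pi fun _ => measurableSet_Ioo),
    ae_restrict_of_ae (ae_all_iff.mpr fun u => ae_all_iff.mpr fun v =>
      (Filter.eventually_all (l := ae (volume : Measure (V → ℝ)))).mpr (hne u v))] with w h1 h2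
  refine ⟨fun u v huv => ?_, fun v => h1 v trivial⟩
  by_contra hne
  exact h2 u v hne huv

/-- The edges `f` with `f ∩ e = {v}` all of whose vertices outside `e` are initially blue. -/
noncomputable def blueEdgesAt {V : Type} [DecidableEq V] (E : Finset (Finset V)) (e : Finset V)
    (ic : V → Bool) (v : V) : Finset (Finset V) :=
  E.filter fun f => f ∩ e = {v} ∧ ∀ u ∈ f, u ∉ e → ic u = true

theorem mem_blueEdgesAt {V : Type} [DecidableEq V] {E : Finset (Finset V)} {e f : Finset V}
    {ic : V → Bool} {v : V} :
    f ∈ blueEdgesAt E e ic v ↔ f ∈ E ∧ f ∩ e = {v} ∧ ∀ u ∈ f, u ∉ e → ic u = true :=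
  Finset.mem_filter

/-- The contribution to `Y_e` of the edges meeting `e` exactly in `v`. -/
noncomputable def vertexY {V : Type} [DecidableEq V] (E : Finset (Finset V)) (e : Finset V)
    (ic : V → Bool) (v : V) : ℝ :=
  ∑ f ∈ blueEdgesAt E e ic v, (1 : ℝ) / (f.card : ℝ)

theorem vertexY_nonneg {V : Type} [DecidableEq V] (E : Finset (Finset V)) (e : Finset V)
    (ic : V → Bool) (v : V) : 0 ≤ vertexY E e ic v :=
  Finset.sum_nonneg fun _ _ => by positivity

theorem sum_inv_le_vertexY {V : Type} [DecidableEq V] (E : Finset (Finset V)) (e : Finset V)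
    (ic : V → Bool) (v : V) :
    ∑ f ∈ blueEdgesAt E e ic v, ((f.card : ℝ) + 1)⁻¹ ≤ vertexY E e ic v := by
  refine Finset.sum_le_sum fun f hf => ?_
  have hv : v ∈ f ∩ e := by simp [(mem_blueEdgesAt.mp hf).2.1]
  have : 0 < f.card := Finset.card_pos.mpr ⟨v, (Finset.mem_inter.mp hv).1⟩
  rw [inv_eq_one_div]
  gcongr
  linarith

theorem sum_vertexY {V : Type} [DecidableEq V] (E : Finset (Finset V)) (e : Finset V)
    (ic : V → Bool) : ∑ v ∈ e, vertexY E e ic v = Yvar E e ic := by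
  unfold vertexY Yvar
  rw [← Finset.sum_biUnion]
  · refine Finset.sum_congr ?_ fun _ _ => rfl
    ext f
    simp only [blueEdgesAt, Finset.mem_biUnion, Finset.mem_filter, Finset.card_eq_one]
    constructor
    · rintro ⟨v, -, hf, hv, hb⟩
      exact ⟨hf, ⟨v, hv⟩, hb⟩
    · rintro ⟨hf, ⟨v, hv⟩, hb⟩
      have : v ∈ f ∩ e := by simp [hv]
      exact ⟨v, (Finset.mem_inter.mp this).2, hf, hv, hb⟩
  · intro v _ v' _ hne
    refine Finset.disjoint_left.mpr fun f hf hf' => hne ?_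
    have h := (mem_blueEdgesAt.mp hf).2.1
    rw [(mem_blueEdgesAt.mp hf').2.1] at h
    exact (Finset.singleton_inj.mp h).symm

theorem vertexY_congr {V : Type} [DecidableEq V] (E : Finset (Finset V)) (e : Finset V)
    {ic ic' : V → Bool} (h : ∀ u ∉ e, ic u = ic' u) : vertexY E e ic = vertexY E e ic' := by
  funext v
  have : blueEdgesAt E e ic v = blueEdgesAt E e ic' v := by
    refine Finset.filter_congr fun f _ => and_congr_right fun _ => ?_
    exact forall₃_congr fun u _ hu => by rw [h u hu]
  rw [vertexY, vertexY, this]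

/-- The largest weight among the vertices of `f` other than `v`. -/
noncomputable def otherMax {V : Type} [DecidableEq V] (f : Finset V) (v : V) (w : V → ℝ) : ℝ :=
  ⨆ u : {u // u ∈ f.erase v}, w u

theorem measurable_otherMax {V : Type} [Fintype V] [DecidableEq V] (f : Finset V) (v : V) :
    Measurable (otherMax f v) :=
  Measurable.iSup fun u => measurable_pi_apply u.1

theorem otherMax_le {V : Type} [DecidableEq V] {f : Finset V} {v : V} {w : V → ℝ} {a : ℝ}
    (ha : 0 ≤ a) (h : ∀ u ∈ f, w u ≤ a) : otherMax f v w ≤ a :=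
  Real.iSup_le (fun u => h u (Finset.mem_of_mem_erase u.2)) ha

theorem secondWeight_le_otherMax {V : Type} [DecidableEq V] (f : Finset V) (v : V) {w : V → ℝ}
    (hw : ∀ u, 0 ≤ w u) : secondWeight f w ≤ otherMax f v w := by
  refine Real.sSup_le ?_ (Real.iSup_nonneg fun u => hw u)
  intro x hx
  obtain ⟨⟨a, b⟩, hab, rfl⟩ := Finset.mem_image.mp (Finset.mem_coe.mp hx)
  obtain ⟨ha, hb, hne⟩ := Finset.mem_offDiag.mp hab
  have hle (u) (hu : u ∈ f) (huv : u ≠ v) : w u ≤ otherMax f v w :=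
    le_ciSup (f := fun u : {u // u ∈ f.erase v} => w u) (Set.finite_range _).bddAbove
      ⟨u, Finset.mem_erase.mpr ⟨huv, hu⟩⟩
  by_cases hav : a = v
  · exact (min_le_right _ _).trans (hle b hb fun h => hne (hav.trans h.symm))
  · exact (min_le_left _ _).trans (hle a ha hav)

theorem d2_nonneg {V : Type} [DecidableEq V] (f : Finset V) (ic : V → Bool) {w : V → ℝ}
    (hw : ∀ u, w u ≤ 1) : 0 ≤ d2 f ic w := by
  unfold d2
  split_ifs
  · refine mul_nonneg (by positivity) (sub_nonneg.mpr (Real.sSup_le ?_ zero_le_one))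
    intro x hx
    obtain ⟨p, -, rfl⟩ := Finset.mem_image.mp (Finset.mem_coe.mp hx)
    exact (min_le_left _ _).trans (hw _)
  · exact le_rfl

/-- If `e` ends up red then some vertex of `e` was initially blue, and every such vertex was
recolored because of an initially blue edge meeting `e` in this vertex only. -/
theorem IsFinalColoring.exists_blueEdgesAt {V : Type} [DecidableEq V] {E : Finset (Finset V)}
    {ic : V → Bool} {w : V → ℝ} {c : V → Bool} (hc : IsFinalColoring E ic w c) {e : Finset V}
    (he : e ∈ E) (hne : e.Nonempty) (hred : ∀ v ∈ e, c v = false) :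
    (e.filter fun v => ic v = true).Nonempty ∧
      ∀ v ∈ e.filter fun v => ic v = true,
        ∃ f ∈ blueEdgesAt E e ic v, Mono ic f ∧ ∀ u ∈ f, w u ≤ w v := by
  constructor
  · by_contra hT
    have hic : ∀ v ∈ e, ic v = false := fun v hv => by
      by_contra h
      exact hT ⟨v, Finset.mem_filter.mpr ⟨hv, by simpa using h⟩⟩
    obtain ⟨v, hv, hmax⟩ := e.exists_max_image w hne
    have := (hc v).1 ⟨e, he, hv, fun a ha b hb => by rw [hic a ha, hic b hb], hmax,
      fun u hu _ => by rw [hred u hu, hic u hu]⟩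
    simp [hred v hv, hic v hv] at this
  · intro v hv
    obtain ⟨hve, hvb⟩ := Finset.mem_filter.mp hv
    have hR : Reason E ic w c v := by
      by_contra h
      have := (hc v).2 h
      simp [hred v hve, hvb] at this
    obtain ⟨f, hf, hvf, hmono, hmax, hkeep⟩ := hR
    have hblue (u) (hu : u ∈ f) : ic u = true := (hmono u hu v hvf).trans hvb
    refine ⟨f, mem_blueEdgesAt.mpr ⟨hf, ?_, fun u hu _ => hblue u hu⟩, hmono, hmax⟩
    refine Finset.eq_singleton_iff_unique_mem.mpr ⟨Finset.mem_inter.mpr ⟨hvf, hve⟩, ?_⟩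
    intro u hu
    obtain ⟨huf, hue⟩ := Finset.mem_inter.mp hu
    by_contra huv
    have := hkeep u huf huv
    simp [hred u hue, hblue u huf] at this

/-- The second weight deficits of distinct reasons are controlled by the total deficit. -/
theorem sum_deficit_le {V : Type} [DecidableEq V] {E : Finset (Finset V)} {e : Finset V}
    {ic : V → Bool} {w : V → ℝ} (hw : ∀ v, w v ∈ Set.Ioo (0 : ℝ) 1) {T : Finset V}
    {g : V → Finset V} (hg : ∀ v ∈ T, g v ∈ blueEdgesAt E e ic v)
    (hmono : ∀ v ∈ T, Mono ic (g v)) :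
    ∑ v ∈ T, (((g v).card : ℝ) + 1) * (1 - otherMax (g v) v w) ≤ ∑ f ∈ E, d2 f ic w := by
  have hinj : Set.InjOn g T := by
    intro v hv v' hv' h
    have h1 := (mem_blueEdgesAt.mp (hg v hv)).2.1
    rw [h, (mem_blueEdgesAt.mp (hg v' hv')).2.1] at h1
    exact (Finset.singleton_inj.mp h1).symm
  calc _ ≤ ∑ v ∈ T, d2 (g v) ic w := by
        refine Finset.sum_le_sum fun v hv => ?_
        rw [d2, if_pos (hmono v hv)]
        have := secondWeight_le_otherMax (g v) v fun u => (hw u).1.le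
        gcongr
    _ = ∑ f ∈ T.image g, d2 f ic w := (Finset.sum_image (f := fun f => d2 f ic w) hinj).symm
    _ ≤ _ := by
        refine Finset.sum_le_sum_of_subset_of_nonneg ?_ fun f _ _ =>
          d2_nonneg f ic fun u => (hw u).2.le
        exact Finset.image_subset_iff.mpr fun v hv => (mem_blueEdgesAt.mp (hg v hv)).1

theorem sum_piFinset_prod {V β : Type*} [Fintype V] [DecidableEq V] (T : Finset V)
    (F : V → Finset β) (d : β) (h : β → ℝ) :
    ∑ g ∈ Fintype.piFinset fun v => if v ∈ T then F v else {d}, ∏ v ∈ T, h (g v) =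
      ∏ v ∈ T, ∑ f ∈ F v, h f := by
  have key := Finset.prod_univ_sum (fun v => if v ∈ T then F v else {d})
    fun v f => if v ∈ T then h f else 1
  simp only [Finset.prod_ite_mem, Finset.univ_inter] at key
  rw [← key, ← Finset.prod_subset (Finset.subset_univ T)]
  · exact Finset.prod_congr rfl fun v hv => by simp [hv]
  · intro v _ hv
    simp [hv]

/-- For fixed initial colors, a bound on the probability over the weights. -/
theorem pi_muW_red_le {V : Type} [Fintype V] [DecidableEq V] (E : Finset (Finset V))
    (ic : V → Bool) (c : (V → ℝ) → V → Bool)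
    (hc : ∀ w, Function.Injective w → IsFinalColoring E ic w (c w)) {e : Finset V} (he : e ∈ E)
    (hne : e.Nonempty) {D : ℝ} (hD : 0 ≤ D) :
    Measure.pi (fun _ : V => muW)
        {w | (∀ v ∈ e, c w v = false) ∧ ∑ f ∈ E, d2 f ic w ≤ D} ≤
      ENNReal.ofReal
        (recolorBound D (vertexY E e ic) (e.filter fun v => ic v = true)) := by
  set T := e.filter fun v => ic v = true
  let S (g : V → Finset V) : Set (V → ℝ) :=
    {w | (∀ v ∈ T, otherMax (g v) v w ≤ w v ∧ otherMax (g v) v w ≤ 1) ∧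
      ∑ v ∈ T, (((g v).card : ℝ) + 1) * (1 - otherMax (g v) v w) ≤ D}
  let t (v : V) : Finset (Finset V) := if v ∈ T then blueEdgesAt E e ic v else {∅}
  have ht (v) (hv : v ∈ T) : t v = blueEdgesAt E e ic v := if_pos hv
  by_cases hT : T.Nonempty
  swap
  · have : ∀ᵐ w ∂Measure.pi (fun _ : V => muW),
        ¬ ((∀ v ∈ e, c w v = false) ∧ ∑ f ∈ E, d2 f ic w ≤ D) := by
      filter_upwards [ae_injective_and_mem_Ioo V] with w hw h
      exact hT ((hc w hw.1).exists_blueEdgesAt he hne h.1).1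
    rw [ae_iff] at this
    simp only [not_not] at this
    rw [this]
    exact zero_le
  have hcover : {w | (∀ v ∈ e, c w v = false) ∧ ∑ f ∈ E, d2 f ic w ≤ D}
      ≤ᵐ[Measure.pi (fun _ : V => muW)] ⋃ g ∈ Fintype.piFinset t, S g := by
    filter_upwards [ae_injective_and_mem_Ioo V] with w hw h
    have hex := ((hc w hw.1).exists_blueEdgesAt he hne h.1).2
    choose! g hg hmono hmax using hex
    let g' (v : V) : Finset V := if v ∈ T then g v else ∅
    have hg' (v) (hv : v ∈ T) : g' v = g v := if_pos hv
    refine Set.mem_iUnion₂.mpr ⟨g', ?_, ?_, ?_⟩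
    · refine Fintype.mem_piFinset.mpr fun v => ?_
      by_cases hv : v ∈ T
      · rw [ht v hv, hg' v hv]
        exact hg v hv
      · simp [t, g', hv]
    · intro v hv
      rw [hg' v hv]
      exact ⟨otherMax_le (hw.2 v).1.le (hmax v hv),
        otherMax_le zero_le_one fun u _ => (hw.2 u).2.le⟩
    · refine (sum_deficit_le (e := e) hw.2 (fun v hv => ?_) fun v hv => ?_).trans h.2
      · rw [hg' v hv]
        exact hg v hv
      · rw [hg' v hv]
        exact hmono v hv
  have hS (g) (hg : g ∈ Fintype.piFinset t) : Measure.pi (fun _ : V => muW) (S g) ≤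
      ENNReal.ofReal ((D / T.card) ^ T.card * ∏ v ∈ T, (((g v).card : ℝ) + 1)⁻¹) := by
    refine pi_muW_threshold_le T (fun v => otherMax (g v) v) (fun v => measurable_otherMax _ _)
      (fun v hv w w' h => ?_) (fun v => ((g v).card : ℝ) + 1) (fun v => by positivity) D
    have hgv := Fintype.mem_piFinset.mp hg v
    rw [ht v hv] at hgv
    have hge := (mem_blueEdgesAt.mp hgv).2.1
    refine iSup_congr fun u => h u fun hu => ?_
    obtain ⟨huv, huf⟩ := Finset.mem_erase.mp u.2
    have : u.1 ∈ g v ∩ e := Finset.mem_inter.mpr ⟨huf, (Finset.mem_filter.mp hu).1⟩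
    rw [hge] at this
    exact huv (Finset.mem_singleton.mp this)
  have hprod : ∑ g ∈ Fintype.piFinset t, ∏ v ∈ T, (((g v).card : ℝ) + 1)⁻¹ =
      ∏ v ∈ T, ∑ f ∈ blueEdgesAt E e ic v, ((f.card : ℝ) + 1)⁻¹ :=
    sum_piFinset_prod T (blueEdgesAt E e ic) ∅ fun f => ((f.card : ℝ) + 1)⁻¹
  have hpow : 0 ≤ (D / T.card) ^ T.card := pow_nonneg (div_nonneg hD (Nat.cast_nonneg _)) _
  calc _ ≤ Measure.pi (fun _ : V => muW) (⋃ g ∈ Fintype.piFinset t, S g) := measure_mono_ae hcover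
    _ ≤ ∑ g ∈ Fintype.piFinset t, Measure.pi (fun _ : V => muW) (S g) :=
        measure_biUnion_finset_le _ _
    _ ≤ ∑ g ∈ Fintype.piFinset t,
          ENNReal.ofReal ((D / T.card) ^ T.card * ∏ v ∈ T, (((g v).card : ℝ) + 1)⁻¹) :=
        Finset.sum_le_sum hS
    _ = ENNReal.ofReal ((D / T.card) ^ T.card *
          ∏ v ∈ T, ∑ f ∈ blueEdgesAt E e ic v, ((f.card : ℝ) + 1)⁻¹) := by
        rw [← ENNReal.ofReal_sum_of_nonneg fun g _ => mul_nonneg hpow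
          (Finset.prod_nonneg fun v _ => by positivity), ← Finset.mul_sum, hprod]
    _ ≤ _ := by
        refine ENNReal.ofReal_le_ofReal ?_
        rw [recolorBound, if_pos hT]
        exact mul_le_mul_of_nonneg_left (Finset.prod_le_prod (fun v _ =>
          Finset.sum_nonneg fun f _ => by positivity) fun v _ => sum_inv_le_vertexY E e ic v) hpow

/-- Averaging over the initial colors inside `e`, for a condition `P` and a bound `b` which only
depend on the colors outside `e`. -/
theorem two_pow_mul_sum_le {V : Type} [Fintype V] [DecidableEq V] (e : Finset V)
    (P : (V → Bool) → Prop) (b : (V → Bool) → Finset V → ℝ) (K : ℝ)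
    (hP : ∀ ic ic' : V → Bool, (∀ u ∉ e, ic u = ic' u) → P ic → P ic')
    (hb : ∀ ic ic' : V → Bool, (∀ u ∉ e, ic u = ic' u) → b ic = b ic')
    (hK : ∀ ic, P ic → ∑ T ∈ e.powerset, b ic T ≤ K) :
    2 ^ e.card * ∑ ic ∈ Finset.univ.filter P, b ic (e.filter fun v => ic v = true) ≤
      (Finset.univ.filter P).card * K := by
  let flip (T : Finset V) (ic : V → Bool) (v : V) : Bool := xor (ic v) (decide (v ∈ T))
  have hflip (T) (ic) : flip T (flip T ic) = ic := by
    funext v; simp [flip]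
  have hout (T) (hT : T ∈ e.powerset) (ic : V → Bool) (u) (hu : u ∉ e) : ic u = flip T ic u := by
    have : u ∉ T := fun h => hu (Finset.mem_powerset.mp hT h)
    simp [flip, this]
  have hinv (T) (hT : T ∈ e.powerset) (ic) (hic : ic ∈ Finset.univ.filter P) :
      flip T ic ∈ Finset.univ.filter P := by
    simp only [Finset.mem_filter, Finset.mem_univ, true_and] at hic ⊢
    exact hP _ _ (hout T hT ic) hic
  have hstep (T) (hT : T ∈ e.powerset) :
      ∑ ic ∈ Finset.univ.filter P, b ic (e.filter fun v => ic v = true) =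
        ∑ ic ∈ Finset.univ.filter P,
          b ic (symmDiff T (e.filter fun v => ic v = true)) := by
    refine Finset.sum_nbij' (flip T) (flip T) (hinv T hT) (hinv T hT) (fun ic _ => hflip T ic)
      (fun ic _ => hflip T ic) fun ic _ => ?_
    rw [hb _ _ (hout T hT ic)]
    congr 1
    ext v
    have : v ∈ T → v ∈ e := fun h => Finset.mem_powerset.mp hT h
    simp only [flip, Finset.mem_symmDiff, Finset.mem_filter]
    by_cases hv : v ∈ T <;> simp [hv, this]
  calc _ = ∑ T ∈ e.powerset, ∑ ic ∈ Finset.univ.filter P,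
          b ic (symmDiff T (e.filter fun v => ic v = true)) := by
        rw [← Finset.sum_congr rfl hstep, Finset.sum_const, Finset.card_powerset, nsmul_eq_mul]
        push_cast
        rfl
    _ = ∑ ic ∈ Finset.univ.filter P, ∑ T ∈ e.powerset, b ic T := by
        rw [Finset.sum_comm]
        refine Finset.sum_congr rfl fun ic _ => ?_
        have hmem (T) (hT : T ∈ e.powerset) :
            symmDiff T (e.filter fun v => ic v = true) ∈ e.powerset := by
          rw [Finset.mem_powerset] at hT ⊢
          intro v hv
          rcases Finset.mem_symmDiff.mp hv with h | h
          · exact hT h.1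
          · exact (Finset.mem_filter.mp h.1).1
        exact Finset.sum_nbij' (fun T => symmDiff T (e.filter fun v => ic v = true))
          (fun T => symmDiff T (e.filter fun v => ic v = true)) hmem hmem
          (fun T _ => symmDiff_symmDiff_cancel_right _ _)
          (fun T _ => symmDiff_symmDiff_cancel_right _ _) fun T _ => rfl
    _ ≤ ∑ ic ∈ Finset.univ.filter P, K :=
        Finset.sum_le_sum fun ic hic => hK ic (Finset.mem_filter.mp hic).2
    _ = _ := by rw [Finset.sum_const, nsmul_eq_mul]

theorem pi_muBool_singleton {V : Type} [Fintype V] (ic : V → Bool) :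
    Measure.pi (fun _ : V => muBool) {ic} = (2⁻¹ : ENNReal) ^ Fintype.card V := by
  rw [Measure.pi_singleton]
  simp [muBool]

/-- The measure of an event is the sum over initial colorings of the measures of its sections. -/
theorem muH_le_sum {V : Type} [Fintype V] (s : Finset (V → Bool))
    (B : Set ((V → Bool) × (V → ℝ))) (hB : ∀ ω ∈ B, ω.1 ∈ s) :
    muH V B ≤ ∑ ic ∈ s, (2⁻¹ : ENNReal) ^ Fintype.card V *
      Measure.pi (fun _ : V => muW) {w | (ic, w) ∈ B} := by
  calc muH V B ≤ muH V (⋃ ic ∈ s, {ic} ×ˢ {w | (ic, w) ∈ B}) :=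
        measure_mono fun ω hω => Set.mem_iUnion₂.mpr ⟨ω.1, hB ω hω, rfl, hω⟩
    _ ≤ ∑ ic ∈ s, muH V ({ic} ×ˢ {w | (ic, w) ∈ B}) := measure_biUnion_finset_le _ _
    _ = _ := Finset.sum_congr rfl fun ic _ => by
        rw [muH, Measure.prod_prod, pi_muBool_singleton]

theorem muH_fst_mem {V : Type} [Fintype V] (s : Finset (V → Bool)) :
    muH V {ω | ω.1 ∈ s} = s.card * (2⁻¹ : ENNReal) ^ Fintype.card V := by
  have : {ω : (V → Bool) × (V → ℝ) | ω.1 ∈ s} = (s : Set (V → Bool)) ×ˢ Set.univ := by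
    ext ω; simp
  rw [this, muH, Measure.prod_prod, measure_univ, mul_one, ← sum_measure_singleton]
  rw [Finset.sum_congr rfl fun ic _ => pi_muBool_singleton ic, Finset.sum_const, nsmul_eq_mul]

/-- There are constants `αA, αD > 0` such that for all sufficiently large `k`, for every
hypergraph with `s_min(H) ≥ k` and `q(H) ≥ 1`, every edge `e` of size `s`, and every value
`y` of `Y_e` attained with positive probability, the conditional probability given `Y_e = y`
that all of `e` gets final color red while neither bad event `A` nor `D` occurs is at most
`(cosh(√(2·αD·q·y)) − 1)/2^s`. -/
theorem red_edge_conditional_bound_improved :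
    ∃ aA aD : ℝ, 0 < aA ∧ 0 < aD ∧
      ∃ k0 : ℕ, ∀ k : ℕ, k0 ≤ k →
        ∀ (V : Type) [Fintype V] [DecidableEq V] (E : Finset (Finset V)),
          (∀ f ∈ E, 2 ≤ f.card) → (∀ f ∈ E, k ≤ f.card) → 1 ≤ qH E →
          ∀ C : (V → Bool) → (V → ℝ) → (V → Bool),
            (∀ ic w, Function.Injective w → IsFinalColoring E ic w (C ic w)) →
            ∀ e ∈ E, ∀ y : ℝ,
              muH V {ω : (V → Bool) × (V → ℝ) | Yvar E e ω.1 = y} ≠ 0 →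
              ProbabilityTheory.cond (muH V)
                  {ω : (V → Bool) × (V → ℝ) | Yvar E e ω.1 = y}
                  {ω : (V → Bool) × (V → ℝ) |
                    (∀ v ∈ e, C ω.1 ω.2 v = false) ∧
                    ¬ BadA E aA (qH E) ω.1 ∧ ¬ BadD E aD (qH E) ω.1 ω.2} ≤
                ENNReal.ofReal
                  ((Real.cosh (Real.sqrt (2 * aD * qH E * y)) - 1) / 2 ^ e.card) := by
  refine ⟨1, 1, one_pos, one_pos, 0, ?_⟩
  intro k _ V _ _ E hE2 _ hq C hC e he y hy
  have hne : e.Nonempty := Finset.card_pos.mp (by have := hE2 e he; omega)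
  have hD : 0 ≤ 1 * qH E := by linarith
  set D := 1 * qH E
  set s : Finset (V → Bool) := Finset.univ.filter fun ic => Yvar E e ic = y with hs
  set K := Real.cosh (Real.sqrt (2 * 1 * qH E * y)) - 1
  have hA : {ω : (V → Bool) × (V → ℝ) | Yvar E e ω.1 = y} = {ω | ω.1 ∈ s} := by
    ext ω; simp [hs]
  have hAm : MeasurableSet {ω : (V → Bool) × (V → ℝ) | ω.1 ∈ s} :=
    measurable_fst (Set.toFinite (s : Set (V → Bool))).measurableSet
  rw [hA] at hy ⊢
  rw [ProbabilityTheory.cond_apply hAm]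
  have havg := two_pow_mul_sum_le e (fun ic => Yvar E e ic = y)
    (fun ic => recolorBound D (vertexY E e ic)) K
    (fun ic ic' h hic => by rw [← hic, ← sum_vertexY, ← sum_vertexY, vertexY_congr E e h])
    (fun ic ic' h => by rw [vertexY_congr E e h])
    (fun ic hic => by
      have := sum_recolorBound_le e hD (vertexY_nonneg E e ic)
      rw [sum_vertexY, hic] at this
      simpa [D, K, mul_assoc] using this)
  have hbound : muH V ({ω | ω.1 ∈ s} ∩ {ω : (V → Bool) × (V → ℝ) |
      (∀ v ∈ e, C ω.1 ω.2 v = false) ∧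
        ¬ BadA E 1 (qH E) ω.1 ∧ ¬ BadD E 1 (qH E) ω.1 ω.2}) ≤
      ENNReal.ofReal (K / 2 ^ e.card) * muH V {ω | ω.1 ∈ s} := by
    refine (muH_le_sum s _ fun ω hω => hω.1).trans ?_
    rw [← Finset.mul_sum, muH_fst_mem, mul_comm, ← mul_assoc]
    gcongr
    calc _ ≤ ∑ ic ∈ s, ENNReal.ofReal
            (recolorBound D (vertexY E e ic) (e.filter fun v => ic v = true)) := by
          refine Finset.sum_le_sum fun ic _ => ?_
          refine le_trans (measure_mono fun w hw => ?_)
            (pi_muW_red_le E ic (C ic) (hC ic) he hne hD)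
          exact ⟨hw.2.1, not_lt.mp hw.2.2.2⟩
      _ = ENNReal.ofReal (∑ ic ∈ s,
            recolorBound D (vertexY E e ic) (e.filter fun v => ic v = true)) :=
          (ENNReal.ofReal_sum_of_nonneg fun ic _ =>
            recolorBound_nonneg hD (vertexY_nonneg E e ic) _).symm
      _ ≤ ENNReal.ofReal (K / 2 ^ e.card * s.card) := by
          refine ENNReal.ofReal_le_ofReal ?_
          rw [div_mul_eq_mul_div, le_div_iff₀ (by positivity), mul_comm, mul_comm K]
          exact havg
      _ = ENNReal.ofReal (K / 2 ^ e.card) * s.card := by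
          rw [ENNReal.ofReal_mul' (by positivity), ENNReal.ofReal_natCast]
  have htop : muH V {ω | ω.1 ∈ s} ≠ ⊤ := by
    rw [muH_fst_mem]
    exact ENNReal.mul_ne_top (by simp) (by simp)
  calc _ ≤ (muH V {ω | ω.1 ∈ s})⁻¹ *
          (ENNReal.ofReal (K / 2 ^ e.card) * muH V {ω | ω.1 ∈ s}) := by gcongr
    _ = ENNReal.ofReal (K / 2 ^ e.card) := by
        rw [mul_left_comm, ENNReal.inv_mul_cancel hy htop, mul_one]
end

section
/- Let H=(V,E) be a hypergraph, w : V → (0,1) an injective weight function, and let the vertices be colored by the greedy procedure: processing vertices in order of increasing weight, a vertex v is colored red if there is an edge f whose maximum-weight vertex is v and all of whose other vertices are already colored blue, and blue otherwise. If after the procedure some edge is monochromatic, then there exist edges f_1, f_2 ∈ E such that the maximum-weight vertex of f_1 equals the minimum-weight vertex of f_2. -/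
open Finset

/-- If the random greedy coloring (process vertices in order of increasing weight; color `v`
red iff some edge has `v` as its maximum-weight vertex with all of its other vertices already
blue) leaves some edge monochromatic, then there are edges `f₁, f₂` such that the
maximum-weight vertex of `f₁` is the minimum-weight vertex of `f₂`
(blue = `true`, red = `false`). -/
theorem greedy_failure_gives_conflicting_pair {V : Type} [Fintype V]
    (E : Finset (Finset V)) (hE : ∀ f ∈ E, 2 ≤ f.card)
    (w : V → ℝ) (hw : Function.Injective w) (hw01 : ∀ v, w v ∈ Set.Ioo (0 : ℝ) 1)
    (c : V → Bool)
    (hc : ∀ v, c v = false ↔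
      ∃ f ∈ E, v ∈ f ∧ (∀ u ∈ f, w u ≤ w v) ∧ ∀ u ∈ f, u ≠ v → c u = true)
    (e : Finset V) (he : e ∈ E) (hmono : ∀ u ∈ e, ∀ u' ∈ e, c u = c u') :
    ∃ f₁ ∈ E, ∃ f₂ ∈ E, ∃ v, v ∈ f₁ ∧ v ∈ f₂ ∧
      (∀ u ∈ f₁, w u ≤ w v) ∧ (∀ u ∈ f₂, w v ≤ w u) := by
  have hne : e.Nonempty := card_pos.mp (by have := hE e he; omega)
  obtain ⟨m, hm, hmax⟩ := e.exists_max_image w hne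
  obtain ⟨v, hv, hmin⟩ := e.exists_min_image w hne
  have hm_red : c m = false := by
    by_contra h
    have hm_blue : c m = true := by simpa using h
    exact h ((hc m).mpr ⟨e, he, hm, hmax, fun u hu _ => (hmono u hu m hm).trans hm_blue⟩)
  obtain ⟨f, hf, hvf, hfmax, _⟩ := (hc v).mp ((hmono v hv m hm).trans hm_red)
  exact ⟨f, hf, e, he, v, hvf, hv, hfmax, hmin⟩
end

section
/- For every real α ≥ 1 there exists k_0 such that for every integer k ≥ k_0, every hypergraph H in which each edge f satisfies k ≤ |f| ≤ α·k and such that q(H) ≤ (1/5)·(k/ln k)^{1/(α+1)} is two colorable. -/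
open Finset

/-- `H = (V, E)` is two colorable (blue = `true`, red = `false`). -/
def TwoColorable {V : Type} (E : Finset (Finset V)) : Prop :=
  ∃ c : V → Bool, ∀ f ∈ E, (∃ v ∈ f, c v = true) ∧ (∃ v ∈ f, c v = false)

/-- Greedy coloring along an injective ranking: a vertex is red exactly when it is the last vertex
of an otherwise blue edge. It can only fail if the last vertex of an edge is the first vertex of
another. -/
theorem exists_last_eq_first_of_not_twoColorable {V β : Type} [LinearOrder β] [WellFoundedLT β]
    {E : Finset (Finset V)} (hE : ∀ f ∈ E, 2 ≤ f.card) {r : V → β} (hr : Function.Injective r)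
    (hcol : ¬ TwoColorable E) :
    ∃ e ∈ E, ∃ f ∈ E, ∃ v ∈ e, v ∈ f ∧ (∀ u ∈ e, r u ≤ r v) ∧ ∀ u ∈ f, r v ≤ r u := by
  classical
  have hwf : WellFounded fun u v : V => r u < r v := InvImage.wf r wellFounded_lt
  let red : V → Prop := hwf.fix fun v ih =>
    ∃ e ∈ E, v ∈ e ∧ ∀ u ∈ e, u ≠ v → ∃ h : r u < r v, ¬ ih u h
  have red_iff : ∀ v, red v ↔ ∃ e ∈ E, v ∈ e ∧ ∀ u ∈ e, u ≠ v → r u < r v ∧ ¬ red u := by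
    intro v
    have h := hwf.fix_eq (C := fun _ => Prop) (fun v ih =>
      ∃ e ∈ E, v ∈ e ∧ ∀ u ∈ e, u ≠ v → ∃ h : r u < r v, ¬ ih u h) v
    change red v = _ at h
    rw [h]
    simp only [exists_prop]
    rfl
  have hne : ∀ f ∈ E, f.Nonempty := fun f hf => card_pos.mp (by linarith [hE f hf])
  by_contra! hno
  refine hcol ⟨fun v => decide (¬ red v), fun f hf => ⟨?_, ?_⟩⟩
  · by_contra! hred
    simp only [ne_eq, decide_eq_true_eq, not_not] at hred
    obtain ⟨v, hv, hmin⟩ := f.exists_min_image r (hne f hf)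
    obtain ⟨e, he, hve, hlast⟩ := (red_iff v).mp (hred v hv)
    obtain ⟨u, hu, hlt⟩ := hno e he f hf v hve hv fun u hu => by
      by_cases huv : u = v
      · rw [huv]
      · exact (hlast u hu huv).1.le
    exact absurd (hmin u hu) (not_le.mpr hlt)
  · by_contra! hblue
    simp only [ne_eq, decide_eq_false_iff_not, not_not] at hblue
    obtain ⟨v, hv, hmax⟩ := f.exists_max_image r (hne f hf)
    exact hblue v hv ((red_iff v).mpr ⟨f, hf, hv, fun u hu huv =>
      ⟨lt_of_le_of_ne (hmax u hu) (hr.ne huv), hblue u hu⟩⟩)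

/-- A version of `exists_last_eq_first_of_not_twoColorable` for weights with ties. -/
theorem exists_inter_eq_singleton_of_not_twoColorable {V : Type} [Fintype V] [DecidableEq V]
    {E : Finset (Finset V)} (hE : ∀ f ∈ E, 2 ≤ f.card) (hcol : ¬ TwoColorable E) (x : V → ℕ) :
    ∃ e ∈ E, ∃ f ∈ E, ∃ v, e ∩ f = {v} ∧ (∀ u ∈ e, x u ≤ x v) ∧ ∀ u ∈ f, x v ≤ x u := by
  let r : V → ℕ ×ₗ Fin (Fintype.card V) := fun v => toLex (x v, Fintype.equivFin V v)
  have hr : Function.Injective r := fun u v h => by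
    have h' := congrArg (fun p => (ofLex p).2) h
    exact (Fintype.equivFin V).injective h'
  have hmono : ∀ {u v}, r u ≤ r v → x u ≤ x v := fun h => by
    rcases Prod.Lex.toLex_le_toLex.mp h with h | h
    · exact h.le
    · exact h.1.le
  obtain ⟨e, he, f, hf, v, hve, hvf, hlast, hfirst⟩ :=
    exists_last_eq_first_of_not_twoColorable hE hr hcol
  refine ⟨e, he, f, hf, v, ?_, fun u hu => hmono (hlast u hu), fun u hu => hmono (hfirst u hu)⟩
  ext u
  simp only [mem_inter, mem_singleton]
  constructor
  · rintro ⟨hue, huf⟩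
    exact hr (le_antisymm (hlast u hue) (hfirst u huf))
  · rintro rfl
    exact ⟨hve, hvf⟩

theorem card_piFinset_ite_range {V : Type} [Fintype V] [DecidableEq V] {N : ℕ} (hN : 0 < N)
    (T : Finset V) (S : V → Finset ℕ) :
    ((Fintype.piFinset fun u => if u ∈ T then S u else range N).card : ℝ) =
      (N : ℝ) ^ Fintype.card V * ∏ u ∈ T, ((S u).card / N : ℝ) := by
  have hN' : (N : ℝ) ≠ 0 := by positivity
  have h : ∏ u ∈ T, ((S u).card / N : ℝ) = ∏ u, if u ∈ T then ((S u).card / N : ℝ) else 1 := by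
    rw [prod_ite_mem, univ_inter]
  rw [h, Fintype.card_piFinset, ← card_univ, ← prod_const, ← prod_mul_distrib]
  push_cast
  refine prod_congr rfl fun u _ => ?_
  split_ifs
  · field_simp
  · simp

/-- The union bound for the greedy coloring with independent weights that are uniform in
`{0, …, N - 1}`. -/
theorem one_le_of_not_twoColorable {V : Type} [Fintype V] {E : Finset (Finset V)}
    (hE : ∀ f ∈ E, 2 ≤ f.card) (hcol : ¬ TwoColorable E) {N L : ℕ} (hN : 0 < N)
    (hL : 2 * L ≤ N) {A B : ℝ} (hB0 : 0 ≤ B)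
    (hA : ∀ e ∈ E, 2 * (L / N : ℝ) ^ e.card ≤ A * 2 ^ (1 - (e.card : ℤ)))
    (hB : ∀ e ∈ E, ∀ f ∈ E, ∀ j ∈ Ico L (N - L),
      (((j + 1 : ℕ) : ℝ) / N) ^ (e.card - 1) * (((N - j : ℕ) : ℝ) / N) ^ (f.card - 1) ≤
        B * (2 ^ (1 - (e.card : ℤ)) * 2 ^ (1 - (f.card : ℤ)))) :
    1 ≤ A * qH E + ((N - 2 * L : ℕ) : ℝ) / N * B * qH E ^ 2 := by
  classical
  let low (e : Finset V) : Finset (V → ℕ) :=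
    Fintype.piFinset fun u => if u ∈ e then range L else range N
  let high (f : Finset V) : Finset (V → ℕ) :=
    Fintype.piFinset fun u => if u ∈ f then Ico (N - L) N else range N
  let mid (e f : Finset V) (j : ℕ) : Finset (V → ℕ) :=
    Fintype.piFinset fun u => if u ∈ e ∪ f then
      (if u ∈ e ∩ f then {j} else if u ∈ e then range (j + 1) else Ico j N) else range N
  let P := (E ×ˢ E).filter fun ef => ∃ v, ef.1 ∩ ef.2 = {v}
  have hcover : (Fintype.piFinset fun _ : V => range N) ⊆
      (E.biUnion low ∪ E.biUnion high) ∪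
        (P ×ˢ Ico L (N - L)).biUnion fun t => mid t.1.1 t.1.2 t.2 := by
    intro x hx
    have hx' : ∀ u, x u < N := by simpa using hx
    obtain ⟨e, he, f, hf, v, hef, hlast, hfirst⟩ :=
      exists_inter_eq_singleton_of_not_twoColorable hE hcol x
    rcases lt_or_ge (x v) L with h1 | h1
    · refine mem_union_left _ (mem_union_left _ (mem_biUnion.mpr ⟨e, he, ?_⟩))
      refine Fintype.mem_piFinset.mpr fun u => ?_
      split_ifs with hu
      · exact mem_range.mpr ((hlast u hu).trans_lt h1)
      · exact mem_range.mpr (hx' u)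
    rcases lt_or_ge (x v) (N - L) with h2 | h2
    · refine mem_union_right _ (mem_biUnion.mpr ⟨((e, f), x v), ?_, ?_⟩)
      · exact mem_product.mpr ⟨mem_filter.mpr ⟨mem_product.mpr ⟨he, hf⟩, v, hef⟩,
          mem_Ico.mpr ⟨h1, h2⟩⟩
      · refine Fintype.mem_piFinset.mpr fun u => ?_
        dsimp only
        split_ifs with hu huv hue
        · rw [hef, mem_singleton] at huv
          rw [huv, mem_singleton]
        · exact mem_range.mpr (Nat.lt_succ_of_le (hlast u hue))
        · exact mem_Ico.mpr ⟨hfirst u ((mem_union.mp hu).resolve_left hue), hx' u⟩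
        · exact mem_range.mpr (hx' u)
    · refine mem_union_left _ (mem_union_right _ (mem_biUnion.mpr ⟨f, hf, ?_⟩))
      refine Fintype.mem_piFinset.mpr fun u => ?_
      split_ifs with hu
      · exact mem_Ico.mpr ⟨h2.trans (hfirst u hu), hx' u⟩
      · exact mem_range.mpr (hx' u)
  have hN' : (0 : ℝ) < N := by exact_mod_cast hN
  set Z : ℝ := (N : ℝ) ^ Fintype.card V with hZ
  have hZ0 : 0 < Z := by positivity
  have hlow : ∀ e, ((low e).card : ℝ) = Z * (L / N : ℝ) ^ e.card := fun e => by
    simp only [low, card_piFinset_ite_range hN, card_range, prod_const, hZ]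
  have hhigh : ∀ f, ((high f).card : ℝ) = Z * (L / N : ℝ) ^ f.card := fun f => by
    have : N - (N - L) = L := by omega
    simp only [high, card_piFinset_ite_range hN, Nat.card_Ico, this, prod_const, hZ]
  have hmid : ∀ ef ∈ P, ∀ j ∈ Ico L (N - L), ((mid ef.1 ef.2 j).card : ℝ) ≤
      Z * (1 / N * (B * (2 ^ (1 - (ef.1.card : ℤ)) * 2 ^ (1 - (ef.2.card : ℤ))))) := by
    rintro ⟨e, f⟩ hef j hj
    obtain ⟨hmem, v, hv⟩ := mem_filter.mp hef
    obtain ⟨he, hf⟩ := mem_product.mp hmem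
    dsimp only at hv he hf ⊢
    have hve : v ∈ e := (mem_inter.mp (hv ▸ mem_singleton_self v)).1
    have hvf : v ∈ f := (mem_inter.mp (hv ▸ mem_singleton_self v)).2
    have hunion : e ∪ f = insert v (e.erase v ∪ f.erase v) := by
      ext u
      simp only [mem_union, mem_insert, mem_erase]
      by_cases huv : u = v <;> simp [huv, hve]
    have hnot : v ∉ e.erase v ∪ f.erase v := by simp
    have hinter : ∀ u, u ∈ e → u ∈ f → u = v := fun u h1 h2 => by
      have : u ∈ e ∩ f := mem_inter.mpr ⟨h1, h2⟩
      rwa [hv, mem_singleton] at this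
    have hdisj : Disjoint (e.erase v) (f.erase v) := disjoint_left.mpr fun u h1 h2 =>
      (mem_erase.mp h1).1 (hinter u (mem_erase.mp h1).2 (mem_erase.mp h2).2)
    refine (card_piFinset_ite_range hN (e ∪ f) _).trans_le ?_
    refine mul_le_mul_of_nonneg_left ?_ hZ0.le
    rw [hunion, prod_insert hnot, prod_union hdisj]
    have h1 : ∏ u ∈ e.erase v, (((if u ∈ e ∩ f then {j} else if u ∈ e then range (j + 1)
        else Ico j N : Finset ℕ).card : ℝ) / N) = (((j + 1 : ℕ) : ℝ) / N) ^ (e.card - 1) := by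
      rw [← card_erase_of_mem hve, ← prod_const]
      refine prod_congr rfl fun u hu => ?_
      obtain ⟨huv, hue⟩ := mem_erase.mp hu
      rw [if_neg (by rw [hv]; simpa using huv), if_pos hue, card_range]
    have h2 : ∏ u ∈ f.erase v, (((if u ∈ e ∩ f then {j} else if u ∈ e then range (j + 1)
        else Ico j N : Finset ℕ).card : ℝ) / N) = (((N - j : ℕ) : ℝ) / N) ^ (f.card - 1) := by
      rw [← card_erase_of_mem hvf, ← prod_const]
      refine prod_congr rfl fun u hu => ?_
      obtain ⟨huv, huf⟩ := mem_erase.mp hu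
      rw [if_neg (by rw [hv]; simpa using huv), if_neg (fun hue => huv (hinter u hue huf)),
        Nat.card_Ico]
    rw [h1, h2, if_pos (by rw [hv]; exact mem_singleton_self v), card_singleton, Nat.cast_one]
    exact mul_le_mul_of_nonneg_left (hB e he f hf j hj) (by positivity)
  have hcard : Z ≤ (∑ e ∈ E, ((low e).card : ℝ) + ∑ f ∈ E, ((high f).card : ℝ)) +
      ∑ t ∈ P ×ˢ Ico L (N - L), ((mid t.1.1 t.1.2 t.2).card : ℝ) := by
    have h := (card_le_card hcover).trans ((card_union_le _ _).trans
      (add_le_add ((card_union_le _ _).trans (add_le_add card_biUnion_le card_biUnion_le))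
        card_biUnion_le))
    rw [Fintype.card_piFinset, prod_const, card_range, card_univ] at h
    rw [hZ]
    exact_mod_cast h
  have hends : ∑ e ∈ E, ((low e).card : ℝ) + ∑ f ∈ E, ((high f).card : ℝ) ≤ Z * (A * qH E) := by
    rw [← sum_add_distrib, qH, mul_sum, mul_sum]
    refine sum_le_sum fun e he => ?_
    rw [hlow, hhigh, ← two_mul, mul_left_comm]
    exact mul_le_mul_of_nonneg_left (hA e he) hZ0.le
  have hpairs : ∑ t ∈ P ×ˢ Ico L (N - L), ((mid t.1.1 t.1.2 t.2).card : ℝ) ≤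
      Z * (((N - 2 * L : ℕ) : ℝ) / N * B * qH E ^ 2) := by
    have hcardIco : (Ico L (N - L)).card = N - 2 * L := by
      rw [Nat.card_Ico]; omega
    calc ∑ t ∈ P ×ˢ Ico L (N - L), ((mid t.1.1 t.1.2 t.2).card : ℝ)
        ≤ ∑ ef ∈ P, ∑ j ∈ Ico L (N - L), Z * (1 / N *
            (B * (2 ^ (1 - (ef.1.card : ℤ)) * 2 ^ (1 - (ef.2.card : ℤ))))) := by
          rw [sum_product]
          exact sum_le_sum fun ef hef => sum_le_sum fun j hj => hmid ef hef j hj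
      _ ≤ ∑ ef ∈ E ×ˢ E, ∑ j ∈ Ico L (N - L), Z * (1 / N *
            (B * (2 ^ (1 - (ef.1.card : ℤ)) * 2 ^ (1 - (ef.2.card : ℤ))))) :=
          sum_le_sum_of_subset_of_nonneg (filter_subset _ _) fun _ _ _ =>
            sum_nonneg fun _ _ => by positivity
      _ = Z * (((N - 2 * L : ℕ) : ℝ) / N * B * qH E ^ 2) := by
          simp only [sum_const, hcardIco, nsmul_eq_mul]
          rw [pow_two, qH, sum_mul_sum, ← sum_product', mul_sum, mul_sum]
          refine sum_congr rfl fun ef _ => ?_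
          ring
  have hfinal : Z * 1 ≤ Z * (A * qH E + ((N - 2 * L : ℕ) : ℝ) / N * B * qH E ^ 2) := by
    rw [mul_one, mul_add]
    exact hcard.trans (add_le_add hends hpairs)
  exact le_of_mul_le_mul_left hfinal hZ0

theorem pow_mul_pow_le_exp {y z s t : ℝ} (hy : 0 ≤ y) (hz : 0 ≤ z) (hys : y ≤ Real.exp s)
    (hyz : y * z ≤ Real.exp t) {m n : ℕ} (hnm : n ≤ m) :
    y ^ m * z ^ n ≤ Real.exp (n * t + (m - n) * s) := by
  obtain ⟨d, rfl⟩ := Nat.exists_eq_add_of_le hnm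
  calc y ^ (n + d) * z ^ n = (y * z) ^ n * y ^ d := by ring
    _ ≤ Real.exp t ^ n * Real.exp s ^ d := by gcongr
    _ = _ := by
      rw [← Real.exp_nat_mul, ← Real.exp_nat_mul, ← Real.exp_add]
      push_cast
      ring_nf

/-- The weight of a conflicting pair of edges at a fixed level in the middle of the range. -/
theorem pow_mul_pow_le_exp_of_le_mul {α k p y z δ : ℝ} (hp : 0 ≤ p)
    (hδ : 0 ≤ δ) (hy : 0 ≤ y) (hz : 0 ≤ z) (hyp : y ≤ 1 + (p + 2 * δ)) (hzp : z ≤ 1 + (p + 2 * δ))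
    (hyz : y * z ≤ (1 + δ) ^ 2) {m n : ℕ} (hm : (m : ℝ) + 1 ≤ α * k) (hn : (n : ℝ) + 1 ≤ α * k)
    (hm' : k ≤ m + 1) (hn' : k ≤ n + 1) :
    y ^ m * z ^ n ≤ Real.exp ((α - 1) * (k * p) + 2 * δ * (α * k)) := by
  have hexp : 1 + (p + 2 * δ) ≤ Real.exp (p + 2 * δ) := by
    linarith [Real.add_one_le_exp (p + 2 * δ)]
  have hyz' : y * z ≤ Real.exp (2 * δ) := by
    refine hyz.trans ?_
    rw [two_mul, Real.exp_add, ← pow_two]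
    gcongr
    linarith [Real.add_one_le_exp δ]
  have key : ∀ a b : ℝ, a + 1 ≤ α * k → k ≤ b + 1 →
      b * (2 * δ) + (a - b) * (p + 2 * δ) ≤ (α - 1) * (k * p) + 2 * δ * (α * k) := by
    intro a b ha hb
    nlinarith [mul_le_mul_of_nonneg_right ha hδ, mul_le_mul_of_nonneg_right ha hp,
      mul_le_mul_of_nonneg_right hb hp]
  rcases le_total n m with h | h
  · exact (pow_mul_pow_le_exp hy hz (hyp.trans hexp) hyz' h).trans
      (Real.exp_le_exp.mpr (key _ _ hm hn'))
  · rw [mul_comm]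
    exact (pow_mul_pow_le_exp hz hy (hzp.trans hexp) (by rwa [mul_comm]) h).trans
      (Real.exp_le_exp.mpr (key _ _ hn hm'))

theorem two_zpow_one_sub_natCast {n : ℕ} (hn : 1 ≤ n) :
    (2 : ℝ) ^ (1 - (n : ℤ)) = (1 / 2) ^ (n - 1) := by
  obtain ⟨m, rfl⟩ := Nat.exists_eq_add_of_le hn
  have : 1 - ((1 + m : ℕ) : ℤ) = -(m : ℤ) := by push_cast; ring
  rw [this, zpow_neg, zpow_natCast, Nat.add_sub_cancel_left, one_div, inv_pow]

theorem two_mul_pow_le_exp_mul_zpow {p x : ℝ} {k n : ℕ} (hn : 1 ≤ n) (hkn : k ≤ n) (hp0 : 0 ≤ p)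
    (hp1 : p ≤ 1) (hx0 : 0 ≤ x) (hx : x ≤ 1 / 2 * (1 - p)) :
    2 * x ^ n ≤ Real.exp (-(k * p)) * 2 ^ (1 - (n : ℤ)) := by
  have hpow : (1 - p) ^ n ≤ Real.exp (-(k * p)) := by
    calc (1 - p) ^ n ≤ (1 - p) ^ k := pow_le_pow_of_le_one (by linarith) (by linarith) hkn
      _ ≤ Real.exp (-p) ^ k :=
          pow_le_pow_left₀ (by linarith) (Real.one_sub_le_exp_neg p) k
      _ = Real.exp (-(k * p)) := by rw [← Real.exp_nat_mul, mul_neg]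
  rw [two_zpow_one_sub_natCast hn]
  obtain ⟨m, rfl⟩ := Nat.exists_eq_add_of_le hn
  calc 2 * x ^ (1 + m) ≤ 2 * (1 / 2 * (1 - p)) ^ (1 + m) := by gcongr
    _ = (1 - p) ^ (1 + m) * (1 / 2) ^ (1 + m - 1) := by
        rw [mul_pow, Nat.add_sub_cancel_left]; ring
    _ ≤ Real.exp (-(k * p)) * (1 / 2) ^ (1 + m - 1) := by gcongr

theorem div_pow_mul_div_pow_le {α k p : ℝ} (hp : 0 ≤ p) {N L j m n : ℕ} (hN : 0 < N)
    (hL : N * (1 - p) / 2 < L + 1) (hj : j ∈ Ico L (N - L)) (hm0 : 1 ≤ m) (hn0 : 1 ≤ n)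
    (hm : k ≤ m ∧ m ≤ α * k) (hn : k ≤ n ∧ n ≤ α * k) :
    (((j + 1 : ℕ) : ℝ) / N) ^ (m - 1) * (((N - j : ℕ) : ℝ) / N) ^ (n - 1) ≤
      Real.exp ((α - 1) * (k * p) + 2 * (1 / N) * (α * k)) *
        (2 ^ (1 - (m : ℤ)) * 2 ^ (1 - (n : ℤ))) := by
  have hN0 : (0 : ℝ) < N := by exact_mod_cast hN
  obtain ⟨hj1, hj2⟩ := mem_Ico.mp hj
  have hj1' : (L : ℝ) ≤ j := by exact_mod_cast hj1
  have hj2' : (j : ℝ) + 1 + L ≤ N := by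
    have : j + 1 + L ≤ N := by omega
    exact_mod_cast this
  have hcast : ((N - j : ℕ) : ℝ) = N - j := Nat.cast_sub (by omega)
  rw [two_zpow_one_sub_natCast hm0, two_zpow_one_sub_natCast hn0, hcast]
  obtain ⟨m, rfl⟩ := Nat.exists_eq_add_of_le hm0
  obtain ⟨n, rfl⟩ := Nat.exists_eq_add_of_le hn0
  rw [Nat.add_sub_cancel_left, Nat.add_sub_cancel_left]
  push_cast at hm hn ⊢
  set y : ℝ := 2 * ((j + 1) / N) with hy
  set z : ℝ := 2 * ((N - j) / N) with hz
  have hyN : y * N = 2 * (j + 1) := by rw [hy]; field_simp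
  have hzN : z * N = 2 * (N - j) := by rw [hz]; field_simp
  have hbound : (1 + (p + 2 * (1 / N : ℝ))) * N = N + N * p + 2 := by field_simp; ring
  have hle : y ^ m * z ^ n ≤ Real.exp ((α - 1) * (k * p) + 2 * (1 / N) * (α * k)) := by
    refine pow_mul_pow_le_exp_of_le_mul hp (by positivity) (by positivity) ?_ ?_ ?_ ?_
      (by linarith) (by linarith) (by linarith) (by linarith)
    · exact mul_nonneg zero_le_two (div_nonneg (by linarith) hN0.le)
    · refine le_of_mul_le_mul_right ?_ hN0
      rw [hyN, hbound]
      linarith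
    · refine le_of_mul_le_mul_right ?_ hN0
      rw [hzN, hbound]
      linarith
    · have hsum : y + z = 2 * (1 + 1 / N) := by rw [hy, hz]; field_simp; ring
      have hamgm : 4 * (y * z) ≤ (y + z) ^ 2 := by linarith [sq_nonneg (y - z)]
      rw [hsum, mul_pow] at hamgm
      linarith
  calc ((j + 1 : ℝ) / N) ^ m * ((N - j) / N) ^ n
      = (y ^ m * z ^ n) * ((1 / 2) ^ m * (1 / 2) ^ n) := by
        rw [mul_mul_mul_comm, ← mul_pow, ← mul_pow, hy, hz]
        ring_nf
    _ ≤ _ := by gcongr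

/-- For every `α ≥ 1` and all sufficiently large `k`: every hypergraph whose edge sizes all
lie in `[k, α·k]` and with `q(H) ≤ (1/5)·(k/ln k)^{1/(α+1)}` is two colorable. -/
theorem two_colorable_of_bounded_edge_sizes (α : ℝ) (hα : 1 ≤ α) :
    ∃ k0 : ℕ, ∀ k : ℕ, k0 ≤ k →
      ∀ (V : Type) [Fintype V] (E : Finset (Finset V)),
        (∀ f ∈ E, 2 ≤ f.card) →
        (∀ f ∈ E, k ≤ f.card ∧ (f.card : ℝ) ≤ α * k) →
        qH E ≤ (1 / 5) * ((k : ℝ) / Real.log k) ^ ((1 : ℝ) / (α + 1)) →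
        TwoColorable E := by
  refine ⟨max 4 ⌈2 * α⌉₊, fun k hk V _ E hE hsize hq => ?_⟩
  have hk4 : (4 : ℝ) ≤ k := by exact_mod_cast (le_max_left _ _).trans hk
  have hkα : 2 * α ≤ k := (Nat.le_ceil _).trans (by exact_mod_cast (le_max_right _ _).trans hk)
  have hk0 : (0 : ℝ) < k := by linarith
  have hlog1 : 1 ≤ Real.log k := by
    rw [Real.le_log_iff_exp_le hk0]
    linarith [Real.exp_one_lt_d9]
  have hlogk : Real.log k ≤ k := (Real.log_le_sub_one_of_pos hk0).trans (by linarith)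
  set M : ℝ := ((k : ℝ) / Real.log k) ^ ((1 : ℝ) / (α + 1)) with hM
  have hbase : 1 ≤ (k : ℝ) / Real.log k := by rwa [one_le_div (by linarith)]
  have hM1 : 1 ≤ M := Real.one_le_rpow hbase (by positivity)
  have hM0 : 0 < M := by linarith
  have hlogM0 : 0 ≤ Real.log M := Real.log_nonneg hM1
  have hMpow : M ^ (α + 1) = k / Real.log k := by
    rw [hM, ← Real.rpow_mul (by linarith), one_div_mul_cancel (by linarith), Real.rpow_one]
  have hlogM : 2 * Real.log M ≤ Real.log k := by
    have h1 : (α + 1) * Real.log M = Real.log (k / Real.log k) := by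
      rw [← Real.log_rpow hM0, hMpow]
    have h2 : Real.log (k / Real.log k) ≤ Real.log k :=
      Real.log_le_log (by linarith) (div_le_self hk0.le hlog1)
    nlinarith
  set p : ℝ := Real.log M / k with hp
  have hkp : k * p = Real.log M := mul_div_cancel₀ _ hk0.ne'
  have hp0 : 0 ≤ p := by positivity
  have hp1 : p ≤ 1 := by
    rw [hp, div_le_one hk0]
    linarith
  set N : ℕ := k ^ 2 with hN
  have hNk : (N : ℝ) = (k : ℝ) ^ 2 := by rw [hN]; push_cast; rfl
  have hN0 : (0 : ℝ) < N := by rw [hNk]; positivity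
  set L : ℕ := ⌊(N : ℝ) * (1 - p) / 2⌋₊ with hL
  have hLle : (L : ℝ) ≤ N * (1 - p) / 2 :=
    Nat.floor_le (div_nonneg (mul_nonneg hN0.le (by linarith)) (by norm_num))
  have hLgt : N * (1 - p) / 2 < L + 1 := Nat.lt_floor_add_one _
  have hNp : 0 ≤ N * p := by positivity
  have h2L : 2 * L ≤ N := by
    have : 2 * (L : ℝ) ≤ N := by linarith
    exact_mod_cast this
  by_contra hcol
  have hA : ∀ e ∈ E, 2 * (L / N : ℝ) ^ e.card ≤ M⁻¹ * 2 ^ (1 - (e.card : ℤ)) := by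
    intro e he
    have hexp : M⁻¹ = Real.exp (-(k * p)) := by rw [hkp, Real.exp_neg, Real.exp_log hM0]
    rw [hexp]
    refine two_mul_pow_le_exp_mul_zpow (by linarith [hE e he]) (hsize e he).1 hp0 hp1
      (by positivity) ?_
    rw [div_le_iff₀ hN0]
    linarith
  set B : ℝ := Real.exp 1 * M ^ (α - 1) with hBdef
  have hB0 : 0 ≤ B := by positivity
  have hB : ∀ e ∈ E, ∀ f ∈ E, ∀ j ∈ Ico L (N - L),
      (((j + 1 : ℕ) : ℝ) / N) ^ (e.card - 1) * (((N - j : ℕ) : ℝ) / N) ^ (f.card - 1) ≤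
        B * (2 ^ (1 - (e.card : ℤ)) * 2 ^ (1 - (f.card : ℤ))) := by
    intro e he f hf j hj
    have hBle : Real.exp ((α - 1) * (k * p) + 2 * (1 / N) * (α * k)) ≤ B := by
      rw [hBdef, Real.rpow_def_of_pos hM0, ← Real.exp_add, hkp]
      refine Real.exp_le_exp.mpr ?_
      have : 2 * (1 / N) * (α * k) ≤ 1 := by
        have h : 2 * (1 / N) * (α * k) = 2 * α / k := by rw [hNk]; field_simp
        rwa [h, div_le_one hk0]
      linarith
    refine (div_pow_mul_div_pow_le hp0 (by exact_mod_cast hN0) hLgt hj (by linarith [hE e he])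
      (by linarith [hE f hf]) ⟨by exact_mod_cast (hsize e he).1, (hsize e he).2⟩
      ⟨by exact_mod_cast (hsize f hf).1, (hsize f hf).2⟩).trans ?_
    exact mul_le_mul_of_nonneg_right hBle (by positivity)
  have hunion := one_le_of_not_twoColorable hE hcol (by exact_mod_cast hN0) h2L hB0 hA hB
  have hq0 : 0 ≤ qH E := sum_nonneg fun _ _ => by positivity
  have hfirst : M⁻¹ * qH E ≤ 1 / 5 := by
    rw [inv_mul_le_iff₀ hM0]
    linarith
  have hwidth : ((N - 2 * L : ℕ) : ℝ) / N ≤ Real.log k / k := by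
    rw [Nat.cast_sub h2L, div_le_div_iff₀ hN0 hk0]
    push_cast
    have hNpk : N * p = k * Real.log M := by
      rw [hNk, pow_two, mul_assoc, hkp]
    have h1 : (N : ℝ) - 2 * L ≤ k * Real.log M + 2 := by linarith
    have h2 : (N : ℝ) - 2 * L ≤ Real.log k * k := by nlinarith
    calc ((N : ℝ) - 2 * L) * k ≤ (Real.log k * k) * k := by gcongr
      _ = Real.log k * N := by rw [hNk]; ring
  have hsecond : ((N - 2 * L : ℕ) : ℝ) / N * B * qH E ^ 2 ≤ Real.exp 1 / 25 := by
    have hMM : M ^ (α - 1) * M ^ 2 = k / Real.log k := by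
      rw [← hMpow, ← Real.rpow_natCast, ← Real.rpow_add hM0]
      congr 1
      push_cast
      ring
    calc ((N - 2 * L : ℕ) : ℝ) / N * B * qH E ^ 2
        ≤ Real.log k / k * B * (1 / 5 * M) ^ 2 := by gcongr
      _ = Real.exp 1 / 25 * (Real.log k / k * (M ^ (α - 1) * M ^ 2)) := by rw [hBdef]; ring
      _ = Real.exp 1 / 25 := by
          rw [hMM]
          field_simp
  linarith [Real.exp_one_lt_d9]
end

section
/- For every ε > 0 there exists k_0 such that for every integer k ≥ k_0, every k-uniform hypergraph with at most 2^{k−1}·(ε·k/(1+ε))^{1/(3+ε)} edges is two colorable. In particular, the minimum number of edges in a k-uniform hypergraph that is not two colorable is at least k^{1/3−o(1)}·2^k. -/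
open Finset

/-- If no edge lies strictly below the window `[a, b)`, none lies at or above it, and no vertex with
weight in the window is both the heaviest of one edge and the lightest of another edge meeting
it only there, then the hypergraph is two colorable. -/
theorem twoColorable_of_weight {V : Type} [Fintype V] {E : Finset (Finset V)} {N : ℕ}
    (w : V → Fin N) (a b : ℕ) (hE : ∀ f ∈ E, 2 ≤ f.card)
    (hlow : ∀ e ∈ E, ∃ u ∈ e, a ≤ (w u : ℕ)) (hhigh : ∀ f ∈ E, ∃ u ∈ f, (w u : ℕ) < b)
    (hmid : ∀ e ∈ E, ∀ f ∈ E, ∀ v, (∀ u, u ∈ e ∧ u ∈ f ↔ u = v) → a ≤ (w v : ℕ) →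
      (w v : ℕ) < b → (∀ u ∈ e, w u ≤ w v) → (∀ u ∈ f, w v ≤ w u) → False) :
    TwoColorable E := by
  classical
  let g : V → Fin N ×ₗ Fin (Fintype.card V) := fun v => toLex (w v, Fintype.equivFin V v)
  have hginj : Function.Injective g := by
    intro x y h
    have h' : (w x, Fintype.equivFin V x) = (w y, Fintype.equivFin V y) := toLex.injective h
    exact (Fintype.equivFin V).injective (Prod.ext_iff.1 h').2
  have hgw : ∀ x y, g x ≤ g y → w x ≤ w y := by
    intro x y h
    rcases Prod.Lex.toLex_le_toLex.1 h with h | h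
    · exact h.le
    · exact h.1.le
  have hne : ∀ f ∈ E, f.Nonempty := fun f hf => card_pos.1 (by have := hE f hf; omega)
  refine ⟨fun v => decide (∃ e ∈ E, v ∈ e ∧ ∀ u ∈ e, g u ≤ g v), fun f hf => ⟨?_, ?_⟩⟩
  · obtain ⟨v, hv, hmax⟩ := exists_max_image f g (hne f hf)
    exact ⟨v, hv, decide_eq_true ⟨f, hf, hv, hmax⟩⟩
  · obtain ⟨v, hv, hmin⟩ := exists_min_image f g (hne f hf)
    refine ⟨v, hv, decide_eq_false ?_⟩
    rintro ⟨e, he, hve, hmax⟩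
    have hew : ∀ u ∈ e, w u ≤ w v := fun u hu => hgw _ _ (hmax u hu)
    have hfw : ∀ u ∈ f, w v ≤ w u := fun u hu => hgw _ _ (hmin u hu)
    obtain ⟨x, hx, hxa⟩ := hlow e he
    obtain ⟨y, hy, hyb⟩ := hhigh f hf
    refine hmid e he f hf v (fun u => ⟨fun h => ?_, ?_⟩) (hxa.trans (hew x hx))
      (lt_of_le_of_lt (hfw y hy) hyb) hew hfw
    · exact hginj (le_antisymm (hmax u h.1) (hmin u h.2))
    · rintro rfl
      exact ⟨hve, hv⟩

theorem card_piFinset_eq_mul_prod_div {V : Type} [Fintype V] [DecidableEq V] {N : ℕ}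
    (hN : 0 < N) (S : V → Finset (Fin N)) :
    ((Fintype.piFinset S).card : ℝ) =
      (N : ℝ) ^ Fintype.card V * ∏ u, ((S u).card : ℝ) / N := by
  have : (N : ℝ) ≠ 0 := by positivity
  rw [Fintype.card_piFinset, prod_div_distrib, prod_const, card_univ]
  push_cast
  field_simp

theorem card_filter_forall_mem {V : Type} [Fintype V] [DecidableEq V] {N : ℕ}
    (hN : 0 < N) (e : Finset V) (T : Finset (Fin N)) :
    ((univ.filter fun w : V → Fin N => ∀ u ∈ e, w u ∈ T).card : ℝ) =
      (N : ℝ) ^ Fintype.card V * ((T.card : ℝ) / N) ^ e.card := by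
  have hN' : (N : ℝ) ≠ 0 := by positivity
  have h : (univ.filter fun w : V → Fin N => ∀ u ∈ e, w u ∈ T) =
      Fintype.piFinset fun u => if u ∈ e then T else univ := by
    ext w
    simp only [mem_filter, mem_univ, true_and, Fintype.mem_piFinset]
    refine forall_congr' fun u => ?_
    split_ifs with hu <;> simp [hu]
  rw [h, card_piFinset_eq_mul_prod_div hN, ← prod_const]
  congr 1
  rw [← prod_subset (subset_univ e)]
  · exact prod_congr rfl fun u hu => by simp [hu]
  · intro u _ hu
    simp [hu, hN']

theorem card_filter_conflict_at_le {V : Type} [Fintype V] [DecidableEq V] {N k : ℕ}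
    (hN : 0 < N) {e f : Finset V} {v : V} (hv : ∀ u, u ∈ e ∧ u ∈ f ↔ u = v)
    (he : e.card = k) (hf : f.card = k) (t : Fin N) :
    ((univ.filter fun w : V → Fin N =>
        w v = t ∧ (∀ u ∈ e, w u ≤ t) ∧ ∀ u ∈ f, t ≤ w u).card : ℝ) ≤
      (N : ℝ) ^ Fintype.card V * (1 / N * ((1 + 1 / (N : ℝ)) ^ 2 / 4) ^ (k - 1)) := by
  have hN' : (0 : ℝ) < N := by positivity
  have hve := ((hv v).2 rfl).1
  have hvf := ((hv v).2 rfl).2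
  let S : V → Finset (Fin N) := fun u =>
    if u = v then {t} else if u ∈ e then Iic t else if u ∈ f then Ici t else univ
  have hsub : (univ.filter fun w : V → Fin N =>
      w v = t ∧ (∀ u ∈ e, w u ≤ t) ∧ ∀ u ∈ f, t ≤ w u) ⊆ Fintype.piFinset S := by
    intro w hw
    simp only [mem_filter, mem_univ, true_and] at hw
    rw [Fintype.mem_piFinset]
    intro u
    simp only [S]
    split_ifs with h1 h2 h3
    · simp [h1, hw.1]
    · simpa using hw.2.1 u h2
    · simpa using hw.2.2 u h3
    · simp
  refine (Nat.cast_le.2 (card_le_card hsub)).trans ?_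
  rw [card_piFinset_eq_mul_prod_div hN]
  refine mul_le_mul_of_nonneg_left ?_ (by positivity)
  have hdisj : Disjoint (e.erase v) (f.erase v) := by
    rw [disjoint_left]
    intro u h1 h2
    rw [mem_erase] at h1 h2
    exact h1.1 ((hv u).1 ⟨h1.2, h2.2⟩)
  have hprod : ∏ u, ((S u).card : ℝ) / N =
      1 / N * ((((t : ℕ) + 1 : ℝ) / N) ^ (k - 1) * ((N - (t : ℕ) : ℝ) / N) ^ (k - 1)) := by
    rw [← prod_subset (subset_univ (insert v (e.erase v ∪ f.erase v))), prod_insert (by simp),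
      prod_union hdisj]
    · congr 1
      · simp [S]
      congr 1
      · rw [← he, ← card_erase_of_mem hve, ← prod_const]
        refine prod_congr rfl fun u hu => ?_
        rw [mem_erase] at hu
        simp [S, hu.1, hu.2]
      · rw [← hf, ← card_erase_of_mem hvf, ← prod_const]
        refine prod_congr rfl fun u hu => ?_
        rw [mem_erase] at hu
        have : u ∉ e := fun h => hu.1 ((hv u).1 ⟨h, hu.2⟩)
        simp [S, hu.1, hu.2, this, Nat.cast_sub t.2.le]
    · intro u _ hu
      simp only [mem_insert, mem_union, mem_erase, not_or, not_and] at hu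
      have h1 := hu.2.1 hu.1
      have h2 := hu.2.2 hu.1
      simp [S, hu.1, h1, h2, hN'.ne']
  rw [hprod, ← mul_pow]
  have ht : ((t : ℕ) : ℝ) ≤ N := by exact_mod_cast t.2.le
  have h0 : (0 : ℝ) ≤ N - (t : ℕ) := by linarith
  gcongr
  have : (1 + 1 / (N : ℝ)) ^ 2 / 4 - ((t : ℕ) + 1 : ℝ) / N * ((N - (t : ℕ) : ℝ) / N) =
      ((N - 1 - 2 * (t : ℕ)) / (2 * N)) ^ 2 := by
    field_simp
    ring
  nlinarith [sq_nonneg ((N - 1 - 2 * (t : ℕ) : ℝ) / (2 * N))]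

theorem card_filter_conflict_le {V : Type} [Fintype V] [DecidableEq V] {N k : ℕ}
    (hN : 0 < N) {e f : Finset V} {v : V} (hv : ∀ u, u ∈ e ∧ u ∈ f ↔ u = v)
    (he : e.card = k) (hf : f.card = k) (M : Finset (Fin N)) :
    ((univ.filter fun w : V → Fin N =>
        w v ∈ M ∧ (∀ u ∈ e, w u ≤ w v) ∧ ∀ u ∈ f, w v ≤ w u).card : ℝ) ≤
      (N : ℝ) ^ Fintype.card V *
        ((M.card : ℝ) / N * ((1 + 1 / (N : ℝ)) ^ 2 / 4) ^ (k - 1)) := by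
  have hsub : (univ.filter fun w : V → Fin N =>
      w v ∈ M ∧ (∀ u ∈ e, w u ≤ w v) ∧ ∀ u ∈ f, w v ≤ w u) ⊆
      M.biUnion fun t => univ.filter fun w : V → Fin N =>
        w v = t ∧ (∀ u ∈ e, w u ≤ t) ∧ ∀ u ∈ f, t ≤ w u := by
    intro w hw
    simp only [mem_filter, mem_univ, true_and] at hw
    simp only [mem_biUnion, mem_filter, mem_univ, true_and]
    exact ⟨w v, hw.1, rfl, hw.2⟩
  calc _ ≤ ((∑ t ∈ M, (univ.filter fun w : V → Fin N =>
          w v = t ∧ (∀ u ∈ e, w u ≤ t) ∧ ∀ u ∈ f, t ≤ w u).card : ℕ) : ℝ) :=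
        Nat.cast_le.2 ((card_le_card hsub).trans card_biUnion_le)
    _ ≤ ∑ t ∈ M,
          (N : ℝ) ^ Fintype.card V * (1 / N * ((1 + 1 / (N : ℝ)) ^ 2 / 4) ^ (k - 1)) := by
        push_cast
        exact sum_le_sum fun t _ => card_filter_conflict_at_le hN hv he hf t
    _ = _ := by
        rw [sum_const, nsmul_eq_mul]
        ring

/-- Union bound over random weights with values in `Fin (2 * a + s)`. -/
theorem twoColorable_of_union_bound {V : Type} [Fintype V] {E : Finset (Finset V)} {k a s N : ℕ}
    (hN : N = 2 * a + s) (hN0 : 0 < N) (hk : 2 ≤ k) (hE : ∀ f ∈ E, f.card = k)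
    (hlt : 2 * E.card * ((a : ℝ) / N) ^ k +
      (E.card : ℝ) ^ 2 * ((s : ℝ) / N * ((1 + 1 / (N : ℝ)) ^ 2 / 4) ^ (k - 1)) < 1) :
    TwoColorable E := by
  classical
  by_contra hcol
  let L : Finset (Fin N) := univ.filter fun t => (t : ℕ) < a
  let R : Finset (Fin N) := univ.filter fun t => a + s ≤ (t : ℕ)
  let M : Finset (Fin N) := univ.filter fun t => a ≤ (t : ℕ) ∧ (t : ℕ) < a + s
  have hcard : ∀ (T : Finset (Fin N)) (b c : ℕ),
      (∀ t ∈ T, b ≤ (t : ℕ) ∧ (t : ℕ) < b + c) → T.card ≤ c := by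
    intro T b c h
    rw [← card_map Fin.valEmbedding]
    refine (card_le_card (t := Ico b (b + c)) fun x hx => ?_).trans (by simp)
    obtain ⟨t, ht, rfl⟩ := mem_map.1 hx
    exact mem_Ico.2 (h t ht)
  have hL : L.card ≤ a := hcard L 0 a fun t ht => by simpa [L] using ht
  have hR : R.card ≤ a := hcard R (a + s) a fun t ht =>
    ⟨by simpa [R] using ht, by have := t.2; omega⟩
  have hM : M.card ≤ s := hcard M a s fun t ht => by simpa [M] using ht
  let inside : Finset V → Finset (Fin N) → Finset (V → Fin N) := fun e T =>
    univ.filter fun w => ∀ u ∈ e, w u ∈ T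
  let conflict : Finset V × Finset V → Finset (V → Fin N) := fun p =>
    univ.filter fun w => ∃ v, (∀ u, u ∈ p.1 ∧ u ∈ p.2 ↔ u = v) ∧
      w v ∈ M ∧ (∀ u ∈ p.1, w u ≤ w v) ∧ ∀ u ∈ p.2, w v ≤ w u
  have hcover : (univ : Finset (V → Fin N)) ⊆
      (E.biUnion fun e => inside e L) ∪ (E.biUnion fun e => inside e R) ∪
        (E ×ˢ E).biUnion conflict := by
    intro w _
    by_contra hw
    simp only [mem_union, mem_biUnion, mem_filter, mem_univ, true_and, inside, conflict, L, R, M,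
      not_or, not_exists, not_and, not_forall, mem_product, Prod.forall, not_lt, not_le] at hw
    obtain ⟨⟨h1, h2⟩, h3⟩ := hw
    refine hcol (twoColorable_of_weight w a (a + s) (fun f hf => (hE f hf).symm ▸ hk)
      (fun e he => ?_) (fun e he => ?_) ?_)
    · obtain ⟨u, hu, h⟩ := h1 e he
      exact ⟨u, hu, h⟩
    · obtain ⟨u, hu, h⟩ := h2 e he
      exact ⟨u, hu, h⟩
    · intro e he f hf v hv ha hb hew hfw
      obtain ⟨u, hu, h⟩ := h3 e f ⟨he, hf⟩ v hv ⟨ha, hb⟩ hew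
      exact absurd (hfw u hu) (not_le.2 h)
  have hNpos : (0 : ℝ) < N := by positivity
  set Q : ℝ := (N : ℝ) ^ Fintype.card V with hQ
  have hQ0 : 0 < Q := by positivity
  have hinside : ∀ T : Finset (Fin N), T.card ≤ a → ∀ e ∈ E,
      ((inside e T).card : ℝ) ≤ Q * ((a : ℝ) / N) ^ k := by
    intro T hT e he
    simp only [inside]
    rw [card_filter_forall_mem hN0, hE e he]
    gcongr
  set D : ℝ := (s : ℝ) / N * ((1 + 1 / (N : ℝ)) ^ 2 / 4) ^ (k - 1) with hD
  have hconf : ∀ p ∈ E ×ˢ E, ((conflict p).card : ℝ) ≤ Q * D := by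
    rintro ⟨e, f⟩ hp
    rw [mem_product] at hp
    by_cases hv : ∃ v, ∀ u, u ∈ e ∧ u ∈ f ↔ u = v
    · obtain ⟨v, hv⟩ := hv
      have hsub : conflict (e, f) ⊆ univ.filter fun w : V → Fin N =>
          w v ∈ M ∧ (∀ u ∈ e, w u ≤ w v) ∧ ∀ u ∈ f, w v ≤ w u := by
        intro w hw
        simp only [conflict, mem_filter, mem_univ, true_and] at hw ⊢
        obtain ⟨v', hv', h⟩ := hw
        obtain rfl : v' = v := (hv v').1 ((hv' v').2 rfl)
        exact h
      refine (Nat.cast_le.2 (card_le_card hsub)).trans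
        ((card_filter_conflict_le hN0 hv (hE e hp.1) (hE f hp.2) M).trans ?_)
      rw [hD]
      gcongr
    · have : conflict (e, f) = ∅ := by
        refine filter_eq_empty_iff.2 fun w _ => ?_
        rintro ⟨v, h, -⟩
        exact hv ⟨v, h⟩
      rw [this]
      simp only [card_empty, Nat.cast_zero, D]
      positivity
  have hsum : ∀ T : Finset (Fin N), T.card ≤ a →
      ((E.biUnion fun e => inside e T).card : ℝ) ≤ E.card * (Q * ((a : ℝ) / N) ^ k) := by
    intro T hT
    refine (Nat.cast_le.2 card_biUnion_le).trans ?_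
    rw [← nsmul_eq_mul]
    push_cast
    exact sum_le_card_nsmul _ _ _ (hinside T hT)
  have hsum' : (((E ×ˢ E).biUnion conflict).card : ℝ) ≤ (E.card : ℝ) ^ 2 * (Q * D) := by
    refine (Nat.cast_le.2 card_biUnion_le).trans ?_
    have := sum_le_card_nsmul _ _ _ hconf
    rw [nsmul_eq_mul, card_product] at this
    push_cast at this ⊢
    rwa [sq]
  have hcardΩ : (((univ : Finset (V → Fin N)).card : ℕ) : ℝ) = Q := by
    simp [hQ]
  have htotal : (((univ : Finset (V → Fin N)).card : ℕ) : ℝ) ≤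
      (E.biUnion fun e => inside e L).card + (E.biUnion fun e => inside e R).card +
        ((E ×ˢ E).biUnion conflict).card := by
    exact_mod_cast (card_le_card hcover).trans
      ((card_union_le _ _).trans (Nat.add_le_add_right (card_union_le _ _) _))
  rw [hcardΩ] at htotal
  have := mul_lt_mul_of_pos_left hlt hQ0
  linarith [hsum L hL, hsum R hR]

theorem eventually_union_bound_lt_one :
    ∀ᶠ x : ℝ in Filter.atTop,
      2 * (x ^ (1 / 3 : ℝ) * Real.exp (-(x ^ (1 / 4 : ℝ) / 2))) + 12 * x ^ (-(1 / 12) : ℝ) < 1 := by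
  have h1 : Filter.Tendsto (fun x : ℝ => x ^ (1 / 3 : ℝ) * Real.exp (-(x ^ (1 / 4 : ℝ) / 2)))
      Filter.atTop (nhds 0) := by
    refine ((tendsto_rpow_mul_exp_neg_mul_atTop_nhds_zero (4 / 3) (1 / 2) (by norm_num)).comp
      (tendsto_rpow_atTop (show (0 : ℝ) < 1 / 4 by norm_num))).congr' ?_
    filter_upwards [Filter.eventually_ge_atTop 0] with x hx
    simp only [Function.comp_apply]
    rw [← Real.rpow_mul hx]
    norm_num
    left
    ring
  have h2 := tendsto_rpow_neg_atTop (show (0 : ℝ) < 1 / 12 by norm_num)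
  have h := (h1.const_mul 2).add (h2.const_mul 12)
  simp only [mul_zero, add_zero] at h
  exact h.eventually_lt_const one_pos

theorem twoColorable_of_card_le_rpow_one_third :
    ∃ k0 : ℕ, ∀ k : ℕ, k0 ≤ k → ∀ (V : Type) [Fintype V] (E : Finset (Finset V)),
      (∀ f ∈ E, f.card = k) → (E.card : ℝ) ≤ 2 ^ k * (k : ℝ) ^ (1 / 3 : ℝ) → TwoColorable E := by
  obtain ⟨k0, hk0⟩ := Filter.eventually_atTop.1
    (tendsto_natCast_atTop_atTop.eventually eventually_union_bound_lt_one)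
  refine ⟨max k0 2, fun k hk V _ E hE hm => ?_⟩
  have hk2 : 2 ≤ k := (le_max_right _ _).trans hk
  have hlt := hk0 k ((le_max_left _ _).trans hk)
  have hkpos : (0 : ℝ) < k := by positivity
  have hk1 : (1 : ℝ) ≤ k := by exact_mod_cast (by omega : 1 ≤ k)
  set y : ℕ := ⌊(k : ℝ) ^ (3 / 4 : ℝ)⌋₊ with hy
  have hX1 : (1 : ℝ) ≤ (k : ℝ) ^ (3 / 4 : ℝ) := Real.one_le_rpow hk1 (by norm_num)
  have hy1 : (y : ℝ) ≤ (k : ℝ) ^ (3 / 4 : ℝ) := Nat.floor_le (by positivity)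
  have hy2 : (k : ℝ) ^ (3 / 4 : ℝ) < y + 1 := Nat.lt_floor_add_one _
  obtain ⟨N, hN⟩ : ∃ N, N = 2 * (k * y) + 2 * k := ⟨_, rfl⟩
  have hNr : (N : ℝ) = 2 * k * (y + 1) := by rw [hN]; push_cast; ring
  have hN2k : 2 * (k : ℝ) ≤ N := by
    rw [hNr]
    nlinarith [mul_nonneg hkpos.le (Nat.cast_nonneg y : (0 : ℝ) ≤ y)]
  have hNpos : (0 : ℝ) < N := by linarith
  have hs : ((2 * k : ℕ) : ℝ) / N = 1 / (y + 1) := by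
    rw [hNr]; push_cast; field_simp
  have ha : ((k * y : ℕ) : ℝ) / N = (1 - 1 / (y + 1)) / 2 := by
    rw [hNr]; push_cast; field_simp; ring
  refine twoColorable_of_union_bound hN (by exact_mod_cast hNpos) hk2 hE (lt_of_le_of_lt ?_ hlt)
  have hp0 : (0 : ℝ) ≤ 1 - 1 / ((y : ℝ) + 1) := by
    rw [sub_nonneg, div_le_one (by positivity)]
    linarith [(Nat.cast_nonneg y : (0 : ℝ) ≤ y)]
  have hquarter : (k : ℝ) ^ (1 / 4 : ℝ) * (k : ℝ) ^ (3 / 4 : ℝ) = k := by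
    rw [← Real.rpow_add hkpos]; norm_num
  have hexp : (1 - 1 / ((y : ℝ) + 1)) ^ k ≤ Real.exp (-((k : ℝ) ^ (1 / 4 : ℝ) / 2)) := by
    calc _ ≤ Real.exp (-(1 / ((y : ℝ) + 1))) ^ k := by
          gcongr
          linarith [Real.add_one_le_exp (-(1 / ((y : ℝ) + 1)))]
      _ = Real.exp (-(k / ((y : ℝ) + 1))) := by
          rw [← Real.exp_nat_mul]; congr 1; ring
      _ ≤ _ := by
          rw [Real.exp_le_exp, neg_le_neg_iff, div_le_div_iff₀ (by norm_num) (by positivity)]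
          nlinarith [Real.rpow_nonneg hkpos.le (1 / 4 : ℝ)]
  have hfac : ((1 + 1 / (N : ℝ)) ^ 2) ^ (k - 1) ≤ 3 := by
    calc _ ≤ (Real.exp (1 / N) ^ 2) ^ (k - 1) := by
          gcongr
          linarith [Real.add_one_le_exp (1 / (N : ℝ))]
      _ = Real.exp ((2 * (k - 1 : ℕ) : ℕ) * (1 / N)) := by
          rw [← pow_mul, ← Real.exp_nat_mul]
      _ ≤ Real.exp 1 := by
          rw [Real.exp_le_exp, mul_one_div, div_le_one hNpos]
          refine le_trans ?_ hN2k
          exact_mod_cast (by omega : 2 * (k - 1) ≤ 2 * k)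
      _ ≤ 3 := Real.exp_one_lt_three.le
  have hpow : (k : ℝ) ^ (1 / 3 : ℝ) * (k : ℝ) ^ (1 / 3 : ℝ) * (1 / (y + 1)) ≤
      (k : ℝ) ^ (-(1 / 12) : ℝ) := by
    calc _ ≤ (k : ℝ) ^ (1 / 3 : ℝ) * (k : ℝ) ^ (1 / 3 : ℝ) * (1 / (k : ℝ) ^ (3 / 4 : ℝ)) := by
          gcongr
      _ = _ := by
          rw [one_div ((k : ℝ) ^ _), ← Real.rpow_neg hkpos.le, ← Real.rpow_add hkpos,
            ← Real.rpow_add hkpos]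
          norm_num
  have h4 : ((2 : ℝ) ^ k) ^ 2 / 4 ^ (k - 1) = 4 := by
    rw [← pow_mul, mul_comm k 2, pow_mul, div_eq_iff (by positivity), ← pow_succ']
    norm_num
    omega
  rw [hs, ha]
  refine add_le_add ?_ ?_
  · calc 2 * (E.card : ℝ) * ((1 - 1 / ((y : ℝ) + 1)) / 2) ^ k
        ≤ 2 * (2 ^ k * (k : ℝ) ^ (1 / 3 : ℝ)) * ((1 - 1 / ((y : ℝ) + 1)) / 2) ^ k := by gcongr
      _ = 2 * ((k : ℝ) ^ (1 / 3 : ℝ) * (1 - 1 / ((y : ℝ) + 1)) ^ k) := by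
          rw [div_pow]; field_simp
      _ ≤ _ := by gcongr
  · calc (E.card : ℝ) ^ 2 * (1 / ((y : ℝ) + 1) * ((1 + 1 / (N : ℝ)) ^ 2 / 4) ^ (k - 1))
        ≤ (2 ^ k * (k : ℝ) ^ (1 / 3 : ℝ)) ^ 2 *
          (1 / ((y : ℝ) + 1) * ((1 + 1 / (N : ℝ)) ^ 2 / 4) ^ (k - 1)) := by gcongr
      _ = ((2 : ℝ) ^ k) ^ 2 / 4 ^ (k - 1) * ((1 + 1 / (N : ℝ)) ^ 2) ^ (k - 1) *
          ((k : ℝ) ^ (1 / 3 : ℝ) * (k : ℝ) ^ (1 / 3 : ℝ) * (1 / (y + 1))) := by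
          rw [div_pow _ (4 : ℝ)]; ring
      _ ≤ 4 * 3 * (k : ℝ) ^ (-(1 / 12) : ℝ) := by
          rw [h4]; gcongr
      _ = _ := by ring

/-- For every `ε > 0` and all sufficiently large `k`, every `k`-uniform hypergraph with at
most `2^{k−1}·(ε·k/(1+ε))^{1/(3+ε)}` edges is two colorable; in particular every
non-two-colorable `k`-uniform hypergraph has at least `k^{1/3−o(1)}·2^k` edges, i.e. for
every `ε > 0` and all large `k` it has more than `2^k·k^{1/3−ε}` edges. -/
theorem uniform_two_colorability_bound :
    (∀ ε : ℝ, 0 < ε → ∃ k0 : ℕ, ∀ k : ℕ, k0 ≤ k →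
      ∀ (V : Type) [Fintype V] (E : Finset (Finset V)),
        (∀ f ∈ E, f.card = k) →
        (E.card : ℝ) ≤ 2 ^ (k - 1) * (ε * k / (1 + ε)) ^ ((1 : ℝ) / (3 + ε)) →
        TwoColorable E) ∧
    (∀ ε : ℝ, 0 < ε → ∃ k0 : ℕ, ∀ k : ℕ, k0 ≤ k →
      ∀ (V : Type) [Fintype V] (E : Finset (Finset V)),
        (∀ f ∈ E, f.card = k) → ¬ TwoColorable E →
        (2 : ℝ) ^ k * (k : ℝ) ^ ((1 : ℝ) / 3 - ε) ≤ E.card) := by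
  obtain ⟨k0, hk0⟩ := twoColorable_of_card_le_rpow_one_third
  refine ⟨fun ε hε => ⟨max k0 1, fun k hk V _ E hE hm => ?_⟩,
    fun ε hε => ⟨max k0 1, fun k hk V _ E hE hcol => ?_⟩⟩
  · have hk1 : (1 : ℝ) ≤ k := by exact_mod_cast (le_max_right _ _).trans hk
    refine hk0 k ((le_max_left _ _).trans hk) V E hE (hm.trans ?_)
    have hbase : ε * k / (1 + ε) ≤ k := by
      rw [div_le_iff₀ (by positivity)]
      nlinarith
    calc (2 : ℝ) ^ (k - 1) * (ε * k / (1 + ε)) ^ ((1 : ℝ) / (3 + ε))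
        ≤ 2 ^ k * (k : ℝ) ^ ((1 : ℝ) / (3 + ε)) := by
          gcongr
          · norm_num
          · omega
      _ ≤ 2 ^ k * (k : ℝ) ^ (1 / 3 : ℝ) := by
          gcongr
          linarith
  · have hk1 : (1 : ℝ) ≤ k := by exact_mod_cast (le_max_right _ _).trans hk
    by_contra! hlt
    refine hcol (hk0 k ((le_max_left _ _).trans hk) V E hE (hlt.le.trans ?_))
    gcongr
    linarith
end
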